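/- arXiv:cs/0611029 — 3 statements merged into one kernel-verified Lean document; each statement's English description precedes it below -/
import Mathlib

section
/- Given a finite Kripke structure M and a PLTL formula ψ in positive normal form, M has an initialised infinite path π such that π ⊨ ψ if and only if there exists k ∈ ℕ such that the PLTL eventuality encoding ⟦M,ψ,k⟧ = ⟦M⟧_k ∧ ⟦LoopConstraints⟧_k ∧ ⟦LastStateFormula⟧_k ∧ ⟦EventualityPLTL⟧_k ∧ ⟦ψ⟧^0_0 is propositionally satisfiable; in particular, if π ⊨_k ψ for some initialised path π of M then ⟦M,ψ,k⟧ is satisfiable. -/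
namespace BMC

/-- PLTL formulas in positive normal form: literals `p`, `¬p`, conjunction,
disjunction, next `X`, until `U`, release `R`, previous `Y`, weak previous `Z`,
since `S` and trigger `T`. -/
inductive PLTL (AP : Type) : Type
  | atom  : AP → PLTL AP
  | natom : AP → PLTL AP
  | conj  : PLTL AP → PLTL AP → PLTL AP
  | disj  : PLTL AP → PLTL AP → PLTL AP
  | next  : PLTL AP → PLTL AP
  | untl  : PLTL AP → PLTL AP → PLTL AP
  | rels  : PLTL AP → PLTL AP → PLTL AP
  | prev  : PLTL AP → PLTL AP
  | wprev : PLTL AP → PLTL AP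
  | since : PLTL AP → PLTL AP → PLTL AP
  | trig  : PLTL AP → PLTL AP → PLTL AP

variable {AP S : Type}

/-- Standard PLTL semantics `π^i ⊨ φ` on an infinite sequence of states `π`
with labelling `L`. -/
def PLTL.sat (L : S → Set AP) (π : ℕ → S) : PLTL AP → ℕ → Prop
  | .atom p, i => p ∈ L (π i)
  | .natom p, i => p ∉ L (π i)
  | .conj f g, i => PLTL.sat L π f i ∧ PLTL.sat L π g i
  | .disj f g, i => PLTL.sat L π f i ∨ PLTL.sat L π g i
  | .next f, i => PLTL.sat L π f (i + 1)
  | .untl f g, i => ∃ j, i ≤ j ∧ PLTL.sat L π g j ∧ ∀ n, i ≤ n → n < j → PLTL.sat L π f n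
  | .rels f g, i => ∀ j, i ≤ j → (PLTL.sat L π g j ∨ ∃ n, i ≤ n ∧ n < j ∧ PLTL.sat L π f n)
  | .prev f, i => 0 < i ∧ PLTL.sat L π f (i - 1)
  | .wprev f, i => i = 0 ∨ PLTL.sat L π f (i - 1)
  | .since f g, i => ∃ j, j ≤ i ∧ PLTL.sat L π g j ∧ ∀ n, j < n → n ≤ i → PLTL.sat L π f n
  | .trig f g, i => ∀ j, j ≤ i → (PLTL.sat L π g j ∨ ∃ n, j < n ∧ n ≤ i ∧ PLTL.sat L π f n)

/-- The no-loop bounded semantics `π^i ⊨_nl φ` with bound `k`: future operators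
are restricted to positions `≤ k`. -/
def PLTL.satNL (L : S → Set AP) (π : ℕ → S) (k : ℕ) : PLTL AP → ℕ → Prop
  | .atom p, i => p ∈ L (π i)
  | .natom p, i => p ∉ L (π i)
  | .conj f g, i => PLTL.satNL L π k f i ∧ PLTL.satNL L π k g i
  | .disj f g, i => PLTL.satNL L π k f i ∨ PLTL.satNL L π k g i
  | .next f, i => i < k ∧ PLTL.satNL L π k f (i + 1)
  | .untl f g, i => ∃ j, i ≤ j ∧ j ≤ k ∧ PLTL.satNL L π k g j ∧
      ∀ n, i ≤ n → n < j → PLTL.satNL L π k f n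
  | .rels f g, i => ∃ j, i ≤ j ∧ j ≤ k ∧ PLTL.satNL L π k f j ∧
      ∀ n, i ≤ n → n ≤ j → PLTL.satNL L π k g n
  | .prev f, i => 0 < i ∧ PLTL.satNL L π k f (i - 1)
  | .wprev f, i => i = 0 ∨ PLTL.satNL L π k f (i - 1)
  | .since f g, i => ∃ j, j ≤ i ∧ PLTL.satNL L π k g j ∧
      ∀ n, j < n → n ≤ i → PLTL.satNL L π k f n
  | .trig f g, i => ∀ j, j ≤ i → (PLTL.satNL L π k g j ∨
      ∃ n, j < n ∧ n ≤ i ∧ PLTL.satNL L π k f n)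

/-- `π` is a (k,l)-loop: `0 < l ≤ k`, `π (l-1) = π k`, and from position `l`
onwards `π` is periodic with period `p = k + 1 - l`. -/
def IsKLoop (π : ℕ → S) (k l : ℕ) : Prop :=
  0 < l ∧ l ≤ k ∧ π (l - 1) = π k ∧ ∀ i, l ≤ i → π (i + (k + 1 - l)) = π i

/-- The bounded semantics `π ⊨_k φ`. -/
def PLTL.bsat (L : S → Set AP) (π : ℕ → S) (k : ℕ) (φ : PLTL AP) : Prop :=
  (∃ l, IsKLoop π k l ∧ PLTL.sat L π φ 0) ∨ PLTL.satNL L π k φ 0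

/-- The past operator depth `δ`. -/
def PLTL.delta : PLTL AP → ℕ
  | .atom _ => 0
  | .natom _ => 0
  | .conj f g => max f.delta g.delta
  | .disj f g => max f.delta g.delta
  | .next f => f.delta
  | .untl f g => max f.delta g.delta
  | .rels f g => max f.delta g.delta
  | .prev f => f.delta + 1
  | .wprev f => f.delta + 1
  | .since f g => max f.delta g.delta + 1
  | .trig f g => max f.delta g.delta + 1

/-- A Kripke structure over state space `S` and atomic propositions `AP`. -/
structure Kripke (S AP : Type) where
  T : S → S → Prop
  I : S → Prop
  L : S → Set AP

/-- The transition relation is total. -/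
def Kripke.Total (M : Kripke S AP) : Prop := ∀ s, ∃ s', M.T s s'

/-- An initialised infinite path of `M`. -/
def Kripke.InitPath (M : Kripke S AP) (π : ℕ → S) : Prop :=
  M.I (π 0) ∧ ∀ i, M.T (π i) (π (i + 1))

end BMC
namespace BMC

variable {AP S : Type}

/-- Model constraints `⟦M⟧_k = I(s_0) ∧ ⋀_{i=1}^k T(s_{i-1}, s_i)`. -/
def ModelC (M : Kripke S AP) (k : ℕ) (s : ℕ → S) : Prop :=
  M.I (s 0) ∧ ∀ i, 1 ≤ i → i ≤ k → M.T (s (i - 1)) (s i)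

/-- Loop constraints `⟦LoopConstraints⟧_k`. -/
def LoopC (k : ℕ) (s : ℕ → S) (lsel inL : ℕ → Prop) (LE : Prop) : Prop :=
  ¬ lsel 0 ∧ ¬ inL 0 ∧
  (∀ i, 1 ≤ i → i ≤ k → (lsel i → s (i - 1) = s k)) ∧
  (∀ i, 1 ≤ i → i ≤ k → (inL i ↔ (inL (i - 1) ∨ lsel i))) ∧
  (∀ i, 1 ≤ i → i ≤ k → (inL (i - 1) → ¬ lsel i)) ∧
  (LE ↔ inL k)

end BMC
namespace BMC

variable {AP S : Type}

/-- Lookup of the virtually unrolled formula variable `⟦φ⟧^d_i`, using the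
convention `⟦φ⟧^d_i = ⟦φ⟧^{δ(φ)}_i` when `d > δ(φ)`. -/
def pV (v : PLTL AP → ℕ → ℕ → Prop) (φ : PLTL AP) (d i : ℕ) : Prop :=
  v φ (min d φ.delta) i

/-- `⟦LastStateFormula⟧_k` constraints for one subformula `φ` of the PLTL
eventuality encoding. -/
def pLastC (k : ℕ) (lsel : ℕ → Prop) (LE : Prop)
    (v : PLTL AP → ℕ → ℕ → Prop) (φ : PLTL AP) : Prop :=
  ∀ d, d ≤ φ.delta →
    (¬ LE → ¬ v φ d (k + 1)) ∧
    (∀ i, 1 ≤ i → i ≤ k → lsel i → (v φ d (k + 1) ↔ pV v φ (d + 1) i))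

/-- The constraints `⟦EventualityPLTL⟧_k` (together with the
`⟦LastStateFormula⟧_k` constraints) of the PLTL eventuality encoding,
generated for a formula and, recursively, all of its subformulas.
`v φ d i` is the formula variable `⟦φ⟧^d_i` and `aux φ i` the auxiliary
variable `⟨⟨Fψ2⟩⟩^{δ(ψ2)}_i` (for until subformulas `φ = ψ1 U ψ2`)
resp. `⟨⟨Gψ2⟩⟩^{δ(ψ2)}_i` (for release subformulas). -/
def pevC (k : ℕ) (L : S → Set AP) (s : ℕ → S) (lsel inL : ℕ → Prop)
    (LE : Prop) (v : PLTL AP → ℕ → ℕ → Prop) (aux : PLTL AP → ℕ → Prop) :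
    PLTL AP → Prop
  | .atom p =>
      (∀ i, i ≤ k → (v (.atom p) 0 i ↔ p ∈ L (s i))) ∧
      pLastC k lsel LE v (.atom p)
  | .natom p =>
      (∀ i, i ≤ k → (v (.natom p) 0 i ↔ p ∉ L (s i))) ∧
      pLastC k lsel LE v (.natom p)
  | .conj f g =>
      pevC k L s lsel inL LE v aux f ∧ pevC k L s lsel inL LE v aux g ∧
      (∀ d, d ≤ (PLTL.conj f g).delta → ∀ i, i ≤ k →
        (v (.conj f g) d i ↔ (pV v f d i ∧ pV v g d i))) ∧
      pLastC k lsel LE v (.conj f g)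
  | .disj f g =>
      pevC k L s lsel inL LE v aux f ∧ pevC k L s lsel inL LE v aux g ∧
      (∀ d, d ≤ (PLTL.disj f g).delta → ∀ i, i ≤ k →
        (v (.disj f g) d i ↔ (pV v f d i ∨ pV v g d i))) ∧
      pLastC k lsel LE v (.disj f g)
  | .next f =>
      pevC k L s lsel inL LE v aux f ∧
      (∀ d, d ≤ (PLTL.next f).delta → ∀ i, i ≤ k →
        (v (.next f) d i ↔ pV v f d (i + 1))) ∧
      pLastC k lsel LE v (.next f)
  | .untl f g =>
      pevC k L s lsel inL LE v aux f ∧ pevC k L s lsel inL LE v aux g ∧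
      (∀ d, d ≤ (PLTL.untl f g).delta → ∀ i, i ≤ k →
        (v (.untl f g) d i ↔
          (pV v g d i ∨ (pV v f d i ∧ v (.untl f g) d (i + 1))))) ∧
      pLastC k lsel LE v (.untl f g) ∧
      (¬ aux (.untl f g) 0) ∧
      (∀ i, 1 ≤ i → i ≤ k →
        (aux (.untl f g) i ↔
          (aux (.untl f g) (i - 1) ∨ (inL i ∧ v g g.delta i)))) ∧
      (LE → v (.untl f g) (PLTL.untl f g).delta k → aux (.untl f g) k)
  | .rels f g =>
      pevC k L s lsel inL LE v aux f ∧ pevC k L s lsel inL LE v aux g ∧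
      (∀ d, d ≤ (PLTL.rels f g).delta → ∀ i, i ≤ k →
        (v (.rels f g) d i ↔
          (pV v g d i ∧ (pV v f d i ∨ v (.rels f g) d (i + 1))))) ∧
      pLastC k lsel LE v (.rels f g) ∧
      (aux (.rels f g) 0) ∧
      (∀ i, 1 ≤ i → i ≤ k →
        (aux (.rels f g) i ↔
          (aux (.rels f g) (i - 1) ∧ (¬ inL i ∨ v g g.delta i)))) ∧
      (LE → aux (.rels f g) k → v (.rels f g) (PLTL.rels f g).delta k)
  | .prev f =>
      pevC k L s lsel inL LE v aux f ∧
      (∀ d, d ≤ (PLTL.prev f).delta → ¬ v (.prev f) d 0) ∧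
      (∀ i, 1 ≤ i → i ≤ k → (v (.prev f) 0 i ↔ pV v f 0 (i - 1))) ∧
      (∀ d, 1 ≤ d → d ≤ (PLTL.prev f).delta → ∀ i, 1 ≤ i → i ≤ k →
        (v (.prev f) d i ↔
          ((lsel i ∧ pV v f (d - 1) k) ∨ (¬ lsel i ∧ pV v f d (i - 1))))) ∧
      pLastC k lsel LE v (.prev f)
  | .wprev f =>
      pevC k L s lsel inL LE v aux f ∧
      (∀ d, d ≤ (PLTL.wprev f).delta → v (.wprev f) d 0) ∧
      (∀ i, 1 ≤ i → i ≤ k → (v (.wprev f) 0 i ↔ pV v f 0 (i - 1))) ∧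
      (∀ d, 1 ≤ d → d ≤ (PLTL.wprev f).delta → ∀ i, 1 ≤ i → i ≤ k →
        (v (.wprev f) d i ↔
          ((lsel i ∧ pV v f (d - 1) k) ∨ (¬ lsel i ∧ pV v f d (i - 1))))) ∧
      pLastC k lsel LE v (.wprev f)
  | .since f g =>
      pevC k L s lsel inL LE v aux f ∧ pevC k L s lsel inL LE v aux g ∧
      (∀ d, d ≤ (PLTL.since f g).delta → (v (.since f g) d 0 ↔ pV v g d 0)) ∧
      (∀ i, 1 ≤ i → i ≤ k →
        (v (.since f g) 0 i ↔
          (pV v g 0 i ∨ (pV v f 0 i ∧ v (.since f g) 0 (i - 1))))) ∧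
      (∀ d, 1 ≤ d → d ≤ (PLTL.since f g).delta → ∀ i, 1 ≤ i → i ≤ k →
        (v (.since f g) d i ↔
          (pV v g d i ∨ (pV v f d i ∧
            ((lsel i ∧ v (.since f g) (d - 1) k) ∨
             (¬ lsel i ∧ v (.since f g) d (i - 1))))))) ∧
      pLastC k lsel LE v (.since f g)
  | .trig f g =>
      pevC k L s lsel inL LE v aux f ∧ pevC k L s lsel inL LE v aux g ∧
      (∀ d, d ≤ (PLTL.trig f g).delta → (v (.trig f g) d 0 ↔ pV v g d 0)) ∧
      (∀ i, 1 ≤ i → i ≤ k →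
        (v (.trig f g) 0 i ↔
          (pV v g 0 i ∧ (pV v f 0 i ∨ v (.trig f g) 0 (i - 1))))) ∧
      (∀ d, 1 ≤ d → d ≤ (PLTL.trig f g).delta → ∀ i, 1 ≤ i → i ≤ k →
        (v (.trig f g) d i ↔
          (pV v g d i ∧ (pV v f d i ∨
            ((lsel i ∧ v (.trig f g) (d - 1) k) ∨
             (¬ lsel i ∧ v (.trig f g) d (i - 1))))))) ∧
      pLastC k lsel LE v (.trig f g)

/-- Satisfiability of the PLTL eventuality encoding
`⟦M,ψ,k⟧ = ⟦M⟧_k ∧ ⟦LoopConstraints⟧_k ∧ ⟦LastStateFormula⟧_k ∧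
⟦EventualityPLTL⟧_k ∧ ⟦ψ⟧^0_0`. -/
def PEvSat (M : Kripke S AP) (ψ : PLTL AP) (k : ℕ) : Prop :=
  ∃ (s : ℕ → S) (lsel inL : ℕ → Prop) (LE : Prop)
    (v : PLTL AP → ℕ → ℕ → Prop) (aux : PLTL AP → ℕ → Prop),
    ModelC M k s ∧ LoopC k s lsel inL LE ∧
    pevC k M.L s lsel inL LE v aux ψ ∧ v ψ 0 0

end BMC

namespace BMC

/-! ### Abstract temporal operators on predicates -/

def Unt (F G : ℕ → Prop) (i : ℕ) : Prop := ∃ j, i ≤ j ∧ G j ∧ ∀ n, i ≤ n → n < j → F n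
def Rel (F G : ℕ → Prop) (i : ℕ) : Prop := ∀ j, i ≤ j → (G j ∨ ∃ n, i ≤ n ∧ n < j ∧ F n)
def Sin (F G : ℕ → Prop) (i : ℕ) : Prop := ∃ j, j ≤ i ∧ G j ∧ ∀ n, j < n → n ≤ i → F n
def Tri (F G : ℕ → Prop) (i : ℕ) : Prop := ∀ j, j ≤ i → (G j ∨ ∃ n, j < n ∧ n ≤ i ∧ F n)

theorem rel_iff_not (F G : ℕ → Prop) (i : ℕ) :
    Rel F G i ↔ ¬ Unt (fun n => ¬ F n) (fun n => ¬ G n) i := by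
  unfold Rel Unt
  push Not
  constructor
  · intro h j hj hg
    rcases h j hj with h | h
    · exact absurd h hg
    · exact h
  · intro h j hj
    by_cases hg : G j
    · exact Or.inl hg
    · exact Or.inr (h j hj hg)

theorem tri_iff_not (F G : ℕ → Prop) (i : ℕ) :
    Tri F G i ↔ ¬ Sin (fun n => ¬ F n) (fun n => ¬ G n) i := by
  unfold Tri Sin
  push Not
  constructor
  · intro h j hj hg
    rcases h j hj with h | h
    · exact absurd h hg
    · exact h
  · intro h j hj
    by_cases hg : G j
    · exact Or.inl hg
    · exact Or.inr (h j hj hg)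

theorem unt_step (F G : ℕ → Prop) (i : ℕ) :
    Unt F G i ↔ G i ∨ (F i ∧ Unt F G (i + 1)) := by
  constructor
  · rintro ⟨j, hj, hg, hf⟩
    rcases Nat.eq_or_lt_of_le hj with h | h
    · subst h; exact Or.inl hg
    · exact Or.inr ⟨hf i le_rfl h, j, h, hg, fun n h1 h2 => hf n (by omega) h2⟩
  · rintro (h | ⟨h, j, hj, hg, hf⟩)
    · exact ⟨i, le_rfl, h, fun n h1 h2 => by omega⟩
    · refine ⟨j, by omega, hg, fun n h1 h2 => ?_⟩
      rcases Nat.eq_or_lt_of_le h1 with h3 | h3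
      · subst h3; exact h
      · exact hf n h3 h2

theorem rel_step (F G : ℕ → Prop) (i : ℕ) :
    Rel F G i ↔ G i ∧ (F i ∨ Rel F G (i + 1)) := by
  rw [rel_iff_not, rel_iff_not, unt_step]
  tauto

theorem sin_zero (F G : ℕ → Prop) : Sin F G 0 ↔ G 0 := by
  constructor
  · rintro ⟨j, hj, hg, -⟩
    obtain rfl : j = 0 := by omega
    exact hg
  · intro h
    exact ⟨0, le_rfl, h, fun n h1 h2 => by omega⟩

theorem sin_step (F G : ℕ → Prop) (i : ℕ) :
    Sin F G (i + 1) ↔ G (i + 1) ∨ (F (i + 1) ∧ Sin F G i) := by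
  constructor
  · rintro ⟨j, hj, hg, hf⟩
    rcases Nat.eq_or_lt_of_le hj with h | h
    · subst h; exact Or.inl hg
    · exact Or.inr ⟨hf _ h le_rfl, j, by omega, hg, fun n h1 h2 => hf n h1 (by omega)⟩
  · rintro (h | ⟨h, j, hj, hg, hf⟩)
    · exact ⟨i + 1, le_rfl, h, fun n h1 h2 => by omega⟩
    · refine ⟨j, by omega, hg, fun n h1 h2 => ?_⟩
      rcases Nat.eq_or_lt_of_le h2 with h3 | h3
      · subst h3; exact h
      · exact hf n h1 (by omega)

theorem tri_zero (F G : ℕ → Prop) : Tri F G 0 ↔ G 0 := by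
  rw [tri_iff_not, sin_zero]; tauto

theorem tri_step (F G : ℕ → Prop) (i : ℕ) :
    Tri F G (i + 1) ↔ G (i + 1) ∧ (F (i + 1) ∨ Tri F G i) := by
  rw [tri_iff_not, tri_iff_not, sin_step]
  tauto

theorem unt_char (F G u : ℕ → Prop) (step : ∀ n, u n ↔ G n ∨ (F n ∧ u (n + 1)))
    (ev : ∀ n, u n → ∃ j, n ≤ j ∧ G j) (n : ℕ) : u n ↔ Unt F G n := by
  have key : ∀ m n, G (n + m) → (u n ↔ Unt F G n) := by
    intro m
    induction m with
    | zero =>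
      intro n h
      rw [step, unt_step]
      simp only [Nat.add_zero] at h
      simp [h]
    | succ m ih =>
      intro n h
      rw [step, unt_step, ih (n + 1) (by rwa [show n + 1 + m = n + (m + 1) by omega])]
  constructor
  · intro h
    obtain ⟨j, hj, hg⟩ := ev n h
    exact (key (j - n) n (by rwa [Nat.add_sub_cancel' hj])).1 h
  · intro h
    obtain ⟨j, hj, hg, -⟩ := id h
    exact (key (j - n) n (by rwa [Nat.add_sub_cancel' hj])).2 h

theorem rel_char (F G u : ℕ → Prop) (step : ∀ n, u n ↔ G n ∧ (F n ∨ u (n + 1)))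
    (ev : ∀ n, ¬ u n → ∃ j, n ≤ j ∧ ¬ G j) (n : ℕ) : u n ↔ Rel F G n := by
  rw [rel_iff_not, ← unt_char (fun n => ¬ F n) (fun n => ¬ G n) (fun n => ¬ u n) _ ev]
  · tauto
  · intro n
    have := step n
    tauto

theorem sin_char (F G u : ℕ → Prop) (N : ℕ) (h0 : u 0 ↔ G 0)
    (step : ∀ n, n + 1 < N → (u (n + 1) ↔ G (n + 1) ∨ (F (n + 1) ∧ u n)))
    (n : ℕ) (hn : n < N) : u n ↔ Sin F G n := by
  induction n with
  | zero => rw [h0, sin_zero]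
  | succ n ih => rw [step n hn, sin_step, ih (by omega)]

theorem tri_char (F G u : ℕ → Prop) (N : ℕ) (h0 : u 0 ↔ G 0)
    (step : ∀ n, n + 1 < N → (u (n + 1) ↔ G (n + 1) ∧ (F (n + 1) ∨ u n)))
    (n : ℕ) (hn : n < N) : u n ↔ Tri F G n := by
  induction n with
  | zero => rw [h0, tri_zero]
  | succ n ih => rw [step n hn, tri_step, ih (by omega)]

/-! ### Periodicity -/

theorem unt_per (F G : ℕ → Prop) (N p : ℕ) (hF : ∀ n, N ≤ n → (F (n + p) ↔ F n))
    (hG : ∀ n, N ≤ n → (G (n + p) ↔ G n)) (n : ℕ) (hn : N ≤ n) :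
    Unt F G (n + p) ↔ Unt F G n := by
  constructor
  · rintro ⟨j, hj, hg, hf⟩
    refine ⟨j - p, by omega, (hG _ (by omega)).1 (by rwa [Nat.sub_add_cancel (by omega)]), ?_⟩
    intro m h1 h2
    exact (hF _ (by omega)).1 (hf _ (by omega) (by omega))
  · rintro ⟨j, hj, hg, hf⟩
    refine ⟨j + p, by omega, (hG _ (by omega)).2 hg, ?_⟩
    intro m h1 h2
    have := (hF (m - p) (by omega)).2 (hf (m - p) (by omega) (by omega))
    rwa [Nat.sub_add_cancel (by omega)] at this

theorem rel_per (F G : ℕ → Prop) (N p : ℕ) (hF : ∀ n, N ≤ n → (F (n + p) ↔ F n))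
    (hG : ∀ n, N ≤ n → (G (n + p) ↔ G n)) (n : ℕ) (hn : N ≤ n) :
    Rel F G (n + p) ↔ Rel F G n := by
  rw [rel_iff_not, rel_iff_not, unt_per _ _ N p _ _ n hn]
  · intro n hn; rw [hF n hn]
  · intro n hn; rw [hG n hn]

theorem sin_per (F G : ℕ → Prop) (N p : ℕ) (hF : ∀ n, N ≤ n → (F (n + p) ↔ F n))
    (hG : ∀ n, N ≤ n → (G (n + p) ↔ G n)) (n : ℕ) (hn : N + p ≤ n) :
    Sin F G (n + p) ↔ Sin F G n := by
  constructor
  · rintro ⟨j, hj, hg, hf⟩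
    by_cases hjN : N + p ≤ j
    · refine ⟨j - p, by omega, (hG _ (by omega)).1 (by rwa [Nat.sub_add_cancel (by omega)]), ?_⟩
      intro m h1 h2
      exact (hF _ (by omega)).1 (hf _ (by omega) (by omega))
    · exact ⟨j, by omega, hg, fun m h1 h2 => hf m h1 (by omega)⟩
  · rintro ⟨j, hj, hg, hf⟩
    by_cases hjN : N ≤ j
    · refine ⟨j + p, by omega, (hG _ (by omega)).2 hg, ?_⟩
      intro m h1 h2
      have := (hF (m - p) (by omega)).2 (hf (m - p) (by omega) (by omega))
      rwa [Nat.sub_add_cancel (by omega)] at this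
    · refine ⟨j, by omega, hg, fun m h1 h2 => ?_⟩
      by_cases hm : m ≤ n
      · exact hf m h1 hm
      · have := (hF (m - p) (by omega)).2 (hf (m - p) (by omega) (by omega))
        rwa [Nat.sub_add_cancel (by omega)] at this

theorem tri_per (F G : ℕ → Prop) (N p : ℕ) (hF : ∀ n, N ≤ n → (F (n + p) ↔ F n))
    (hG : ∀ n, N ≤ n → (G (n + p) ↔ G n)) (n : ℕ) (hn : N + p ≤ n) :
    Tri F G (n + p) ↔ Tri F G n := by
  rw [tri_iff_not, tri_iff_not, sin_per _ _ N p _ _ n hn]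
  · intro n hn; rw [hF n hn]
  · intro n hn; rw [hG n hn]

section
variable {AP S : Type}

theorem sat_per (L : S → Set AP) (π : ℕ → S) (l p : ℕ) (hp : 1 ≤ p)
    (hπ : ∀ n, l ≤ n → π (n + p) = π n) (φ : PLTL AP) :
    ∀ n, l + φ.delta * p ≤ n → (PLTL.sat L π φ (n + p) ↔ PLTL.sat L π φ n) := by
  have mx1 : ∀ f g : PLTL AP, f.delta * p ≤ max f.delta g.delta * p :=
    fun f g => Nat.mul_le_mul_right _ (le_max_left _ _)
  have mx2 : ∀ f g : PLTL AP, g.delta * p ≤ max f.delta g.delta * p :=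
    fun f g => Nat.mul_le_mul_right _ (le_max_right _ _)
  induction φ with
  | atom q => intro n hn; simp only [PLTL.sat]; rw [hπ n (by omega)]
  | natom q => intro n hn; simp only [PLTL.sat]; rw [hπ n (by omega)]
  | conj f g ihf ihg =>
    intro n hn
    have := mx1 f g; have := mx2 f g
    simp only [PLTL.delta] at hn
    simp only [PLTL.sat]; rw [ihf n (by omega), ihg n (by omega)]
  | disj f g ihf ihg =>
    intro n hn
    have := mx1 f g; have := mx2 f g
    simp only [PLTL.delta] at hn
    simp only [PLTL.sat]; rw [ihf n (by omega), ihg n (by omega)]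
  | next f ihf =>
    intro n hn
    simp only [PLTL.delta] at hn
    simp only [PLTL.sat]
    rw [Nat.add_right_comm, ihf (n + 1) (by omega)]
  | untl f g ihf ihg =>
    intro n hn
    have := mx1 f g; have := mx2 f g
    simp only [PLTL.delta] at hn
    exact unt_per _ _ _ p (fun m hm => ihf m (by omega)) (fun m hm => ihg m (by omega)) n hn
  | rels f g ihf ihg =>
    intro n hn
    have := mx1 f g; have := mx2 f g
    simp only [PLTL.delta] at hn
    exact rel_per _ _ _ p (fun m hm => ihf m (by omega)) (fun m hm => ihg m (by omega)) n hn
  | prev f ihf =>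
    intro n hn
    simp only [PLTL.delta, Nat.add_mul] at hn
    simp only [PLTL.sat]
    rw [← ihf (n - 1) (by omega), show n + p - 1 = n - 1 + p by omega]
    exact and_congr_left fun _ => by omega
  | wprev f ihf =>
    intro n hn
    simp only [PLTL.delta, Nat.add_mul] at hn
    simp only [PLTL.sat]
    rw [← ihf (n - 1) (by omega), show n + p - 1 = n - 1 + p by omega]
    exact or_congr_left (by omega)
  | since f g ihf ihg =>
    intro n hn
    have := mx1 f g; have := mx2 f g
    simp only [PLTL.delta, Nat.add_mul] at hn
    exact sin_per _ _ (l + max f.delta g.delta * p) p (fun m hm => ihf m (by omega))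
      (fun m hm => ihg m (by omega)) n (by omega)
  | trig f g ihf ihg =>
    intro n hn
    have := mx1 f g; have := mx2 f g
    simp only [PLTL.delta, Nat.add_mul] at hn
    exact tri_per _ _ (l + max f.delta g.delta * p) p (fun m hm => ihf m (by omega))
      (fun m hm => ihg m (by omega)) n (by omega)

/-! ### Coordinates on a lasso -/

def dd (k l n : ℕ) : ℕ := (n - l) / (k + 1 - l)
def ii (k l n : ℕ) : ℕ := n - dd k l n * (k + 1 - l)

theorem coord_mk (k l i D : ℕ) (h : D = 0 ∨ l ≤ i) (hi : i ≤ k) (hl : l ≤ k) :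
    dd k l (i + D * (k + 1 - l)) = D ∧ ii k l (i + D * (k + 1 - l)) = i := by
  have h1 : dd k l (i + D * (k + 1 - l)) = D := by
    unfold dd
    rcases h with h | h
    · subst h
      exact Nat.div_eq_of_lt (by omega)
    · rw [Nat.sub_add_comm h, Nat.add_mul_div_right _ _ (by omega),
        Nat.div_eq_of_lt (by omega)]
      omega
  refine ⟨h1, ?_⟩
  unfold ii
  rw [h1]; omega

theorem coord_ex (k l : ℕ) (hl : l ≤ k) (n : ℕ) :
    ∃ i D, (D = 0 ∨ l ≤ i) ∧ i ≤ k ∧ n = i + D * (k + 1 - l) := by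
  by_cases h : n < l
  · exact ⟨n, 0, Or.inl rfl, by omega, by omega⟩
  · refine ⟨l + (n - l) % (k + 1 - l), (n - l) / (k + 1 - l), Or.inr (by omega), ?_, ?_⟩
    · have := Nat.mod_lt (n - l) (show k + 1 - l > 0 by omega)
      omega
    · have := Nat.mod_add_div (n - l) (k + 1 - l)
      rw [Nat.mul_comm] at this
      omega

theorem coord_spec (k l : ℕ) (hl : l ≤ k) (n : ℕ) :
    (dd k l n = 0 ∨ l ≤ ii k l n) ∧ ii k l n ≤ k ∧ n = ii k l n + dd k l n * (k + 1 - l) := by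
  obtain ⟨i, D, h1, h2, h3⟩ := coord_ex k l hl n
  obtain ⟨h4, h5⟩ := coord_mk k l i D h1 h2 hl
  rw [← h3] at h4 h5
  rw [h4, h5]
  exact ⟨h1, h2, h3⟩

theorem coord_small (k l : ℕ) (hl : l ≤ k) (n : ℕ) (hn : n ≤ k) :
    dd k l n = 0 ∧ ii k l n = n := by
  simpa using coord_mk k l n 0 (Or.inl rfl) hn hl

theorem coord_succ (k l : ℕ) (hl : l ≤ k) (n : ℕ) :
    (ii k l n < k ∧ dd k l (n + 1) = dd k l n ∧ ii k l (n + 1) = ii k l n + 1) ∨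
    (ii k l n = k ∧ dd k l (n + 1) = dd k l n + 1 ∧ ii k l (n + 1) = l) := by
  obtain ⟨h1, h2, h3⟩ := coord_spec k l hl n
  rcases Nat.lt_or_ge (ii k l n) k with h | h
  · left
    obtain ⟨h4, h5⟩ := coord_mk k l (ii k l n + 1) (dd k l n) (by omega) (by omega) hl
    rw [show ii k l n + 1 + dd k l n * (k + 1 - l) = n + 1 by omega] at h4 h5
    exact ⟨h, h4, h5⟩
  · right
    obtain ⟨h4, h5⟩ := coord_mk k l l (dd k l n + 1) (by omega) (by omega) hl
    rw [show l + (dd k l n + 1) * (k + 1 - l) = n + 1 by rw [Nat.add_mul]; omega] at h4 h5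
    exact ⟨by omega, h4, h5⟩

theorem coord_per (k l : ℕ) (hl : l ≤ k) (n : ℕ) (hn : l ≤ n) :
    dd k l (n + (k + 1 - l)) = dd k l n + 1 ∧ ii k l (n + (k + 1 - l)) = ii k l n := by
  obtain ⟨h1, h2, h3⟩ := coord_spec k l hl n
  have h6 : l ≤ ii k l n := by
    rcases h1 with h | h
    · rw [h] at h3; omega
    · exact h
  obtain ⟨h4, h5⟩ := coord_mk k l (ii k l n) (dd k l n + 1) (by omega) (by omega) hl
  rw [show ii k l n + (dd k l n + 1) * (k + 1 - l) = n + (k + 1 - l) by rw [Nat.add_mul]; omega] at h4 h5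
  exact ⟨h4, h5⟩

theorem coord_loop (k l : ℕ) (hl : l ≤ k) (n : ℕ) (hn : l ≤ n) : l ≤ ii k l n := by
  obtain ⟨h1, h2, h3⟩ := coord_spec k l hl n
  rcases h1 with h | h
  · rw [h] at h3; omega
  · exact h

/-! ### Completeness for loops -/

def VV (L : S → Set AP) (π : ℕ → S) (l p : ℕ) : PLTL AP → ℕ → ℕ → Prop
  | .atom q, _, i => q ∈ L (π i)
  | .natom q, _, i => q ∉ L (π i)
  | .conj f g, d, i => VV L π l p f d i ∧ VV L π l p g d i
  | .disj f g, d, i => VV L π l p f d i ∨ VV L π l p g d i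
  | .next f, d, i => VV L π l p f d (i + 1)
  | .untl f g, d, i => Unt (VV L π l p f d) (VV L π l p g d) i
  | .rels f g, d, i => Rel (VV L π l p f d) (VV L π l p g d) i
  | .prev f, d, i => (l ≤ i ∧ PLTL.sat L π (.prev f) (i + d * p)) ∨
      (i < l ∧ 0 < i ∧ VV L π l p f d (i - 1))
  | .wprev f, d, i => (l ≤ i ∧ PLTL.sat L π (.wprev f) (i + d * p)) ∨
      (i < l ∧ (i = 0 ∨ VV L π l p f d (i - 1)))
  | .since f g, d, i => (l ≤ i ∧ PLTL.sat L π (.since f g) (i + d * p)) ∨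
      (i < l ∧ Sin (VV L π l p f d) (VV L π l p g d) i)
  | .trig f g, d, i => (l ≤ i ∧ PLTL.sat L π (.trig f g) (i + d * p)) ∨
      (i < l ∧ Tri (VV L π l p f d) (VV L π l p g d) i)

theorem per_mul (π : ℕ → S) (l p : ℕ) (hπ : ∀ n, l ≤ n → π (n + p) = π n) (d n : ℕ)
    (hn : l ≤ n) : π (n + d * p) = π n := by
  induction d with
  | zero => simp
  | succ d ih => rw [Nat.add_mul, Nat.one_mul, ← Nat.add_assoc, hπ _ (by omega), ih]

theorem unt_shift (F G F' G' : ℕ → Prop) (c i : ℕ) (hF : ∀ n, i ≤ n → (F n ↔ F' (n + c)))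
    (hG : ∀ n, i ≤ n → (G n ↔ G' (n + c))) : Unt F G i ↔ Unt F' G' (i + c) := by
  constructor
  · rintro ⟨j, hj, hg, hf⟩
    refine ⟨j + c, by omega, (hG _ hj).1 hg, fun n h1 h2 => ?_⟩
    have := (hF (n - c) (by omega)).1 (hf _ (by omega) (by omega))
    rwa [Nat.sub_add_cancel (by omega)] at this
  · rintro ⟨j, hj, hg, hf⟩
    refine ⟨j - c, by omega, (hG _ (by omega)).2 (by rwa [Nat.sub_add_cancel (by omega)]),
      fun n h1 h2 => ?_⟩
    exact (hF n h1).2 (hf _ (by omega) (by omega))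

theorem rel_shift (F G F' G' : ℕ → Prop) (c i : ℕ) (hF : ∀ n, i ≤ n → (F n ↔ F' (n + c)))
    (hG : ∀ n, i ≤ n → (G n ↔ G' (n + c))) : Rel F G i ↔ Rel F' G' (i + c) := by
  rw [rel_iff_not, rel_iff_not, unt_shift _ _ (fun n => ¬ F' n) (fun n => ¬ G' n) c]
  · intro n hn; rw [hF n hn]
  · intro n hn; rw [hG n hn]

theorem VV_loop (L : S → Set AP) (π : ℕ → S) (l p : ℕ)
    (hπ : ∀ n, l ≤ n → π (n + p) = π n) (φ : PLTL AP) (d : ℕ) :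
    ∀ i, l ≤ i → (VV L π l p φ d i ↔ PLTL.sat L π φ (i + d * p)) := by
  induction φ with
  | atom q => intro i hi; simp only [VV, PLTL.sat]; rw [per_mul π l p hπ d i hi]
  | natom q => intro i hi; simp only [VV, PLTL.sat]; rw [per_mul π l p hπ d i hi]
  | conj f g ihf ihg => intro i hi; simp only [VV, PLTL.sat]; rw [ihf i hi, ihg i hi]
  | disj f g ihf ihg => intro i hi; simp only [VV, PLTL.sat]; rw [ihf i hi, ihg i hi]
  | next f ihf =>
    intro i hi; simp only [VV, PLTL.sat]; rw [ihf (i + 1) (by omega), Nat.add_right_comm]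
  | untl f g ihf ihg =>
    intro i hi
    exact unt_shift _ _ _ _ _ _ (fun n hn => ihf n (by omega)) (fun n hn => ihg n (by omega))
  | rels f g ihf ihg =>
    intro i hi
    exact rel_shift _ _ _ _ _ _ (fun n hn => ihf n (by omega)) (fun n hn => ihg n (by omega))
  | prev f ihf => intro i hi; simp only [VV, hi, Nat.not_lt.2 hi, true_and, false_and, or_false]
  | wprev f ihf => intro i hi; simp only [VV, hi, Nat.not_lt.2 hi, true_and, false_and, or_false]
  | since f g ihf ihg => intro i hi; simp only [VV, hi, Nat.not_lt.2 hi, true_and, false_and, or_false]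
  | trig f g ihf ihg => intro i hi; simp only [VV, hi, Nat.not_lt.2 hi, true_and, false_and, or_false]

theorem VV_zero (L : S → Set AP) (π : ℕ → S) (l p : ℕ) (φ : PLTL AP) :
    ∀ i, (VV L π l p φ 0 i ↔ PLTL.sat L π φ i) := by
  have key : ∀ i, ∀ A : Prop, (l ≤ i ∧ A) ∨ (i < l ∧ A) ↔ A := by
    intro i A
    have := Nat.lt_or_ge i l
    tauto
  induction φ with
  | atom q => intro i; simp only [VV, PLTL.sat]
  | natom q => intro i; simp only [VV, PLTL.sat]
  | conj f g ihf ihg => intro i; simp only [VV, PLTL.sat, ihf, ihg]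
  | disj f g ihf ihg => intro i; simp only [VV, PLTL.sat, ihf, ihg]
  | next f ihf => intro i; simp only [VV, PLTL.sat, ihf]
  | untl f g ihf ihg => intro i; simp only [VV, PLTL.sat, ihf, ihg, Unt]
  | rels f g ihf ihg => intro i; simp only [VV, PLTL.sat, ihf, ihg, Rel]
  | prev f ihf =>
    intro i; simp only [VV, PLTL.sat, ihf, Nat.zero_mul, Nat.add_zero]; exact key _ _
  | wprev f ihf =>
    intro i; simp only [VV, PLTL.sat, ihf, Nat.zero_mul, Nat.add_zero]; exact key _ _
  | since f g ihf ihg =>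
    intro i; simp only [VV, PLTL.sat, ihf, ihg, Nat.zero_mul, Nat.add_zero, Sin]; exact key _ _
  | trig f g ihf ihg =>
    intro i; simp only [VV, PLTL.sat, ihf, ihg, Nat.zero_mul, Nat.add_zero, Tri]; exact key _ _

theorem VV_stab_aux (L : S → Set AP) (π : ℕ → S) (l p : ℕ) (hp : 1 ≤ p)
    (hπ : ∀ n, l ≤ n → π (n + p) = π n) (φ : PLTL AP) :
    ∀ d, φ.delta ≤ d → ∀ i, (VV L π l p φ (d + 1) i ↔ VV L π l p φ d i) := by
  have key : ∀ φ : PLTL AP, ∀ d, φ.delta ≤ d → ∀ i, l ≤ i →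
      (PLTL.sat L π φ (i + (d + 1) * p) ↔ PLTL.sat L π φ (i + d * p)) := by
    intro φ d hd i hi
    have h := Nat.mul_le_mul_right p hd
    rw [Nat.add_mul, Nat.one_mul, ← Nat.add_assoc, sat_per L π l p hp hπ φ _ (by omega)]
  induction φ with
  | atom q => intro d hd i; simp only [VV]
  | natom q => intro d hd i; simp only [VV]
  | conj f g ihf ihg =>
    intro d hd i; simp only [PLTL.delta, max_le_iff] at hd
    simp only [VV, ihf d hd.1, ihg d hd.2]
  | disj f g ihf ihg =>
    intro d hd i; simp only [PLTL.delta, max_le_iff] at hd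
    simp only [VV, ihf d hd.1, ihg d hd.2]
  | next f ihf =>
    intro d hd i; simp only [PLTL.delta] at hd
    simp only [VV, ihf d hd]
  | untl f g ihf ihg =>
    intro d hd i; simp only [PLTL.delta, max_le_iff] at hd
    simp only [VV, Unt, ihf d hd.1, ihg d hd.2]
  | rels f g ihf ihg =>
    intro d hd i; simp only [PLTL.delta, max_le_iff] at hd
    simp only [VV, Rel, ihf d hd.1, ihg d hd.2]
  | prev f ihf =>
    intro d hd i
    have h1 := key _ d hd i
    simp only [PLTL.delta] at hd
    simp only [VV, ihf d (by omega)]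
    rw [and_congr_right h1]
  | wprev f ihf =>
    intro d hd i
    have h1 := key _ d hd i
    simp only [PLTL.delta] at hd
    simp only [VV, ihf d (by omega)]
    rw [and_congr_right h1]
  | since f g ihf ihg =>
    intro d hd i
    have h1 := key _ d hd i
    simp only [PLTL.delta] at hd
    simp only [VV, Sin, ihf d (by omega), ihg d (by omega)]
    rw [and_congr_right h1]
  | trig f g ihf ihg =>
    intro d hd i
    have h1 := key _ d hd i
    simp only [PLTL.delta] at hd
    simp only [VV, Tri, ihf d (by omega), ihg d (by omega)]
    rw [and_congr_right h1]

theorem pV_VV (L : S → Set AP) (π : ℕ → S) (l p : ℕ) (hp : 1 ≤ p)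
    (hπ : ∀ n, l ≤ n → π (n + p) = π n) (φ : PLTL AP) (d i : ℕ) :
    pV (VV L π l p) φ d i ↔ VV L π l p φ d i := by
  unfold pV
  rcases Nat.le_total d φ.delta with h | h
  · rw [min_eq_left h]
  · rw [min_eq_right h]
    induction d, h using Nat.le_induction with
    | base => rfl
    | succ d hd ih => rw [VV_stab_aux L π l p hp hπ φ d hd, ih]

theorem sat_prev_succ (L : S → Set AP) (π : ℕ → S) (f : PLTL AP) (n : ℕ) :
    PLTL.sat L π (.prev f) (n + 1) ↔ PLTL.sat L π f n := by simp [PLTL.sat]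

theorem sat_wprev_succ (L : S → Set AP) (π : ℕ → S) (f : PLTL AP) (n : ℕ) :
    PLTL.sat L π (.wprev f) (n + 1) ↔ PLTL.sat L π f n := by simp [PLTL.sat]

theorem sat_since_succ (L : S → Set AP) (π : ℕ → S) (f g : PLTL AP) (n : ℕ) :
    PLTL.sat L π (.since f g) (n + 1) ↔ PLTL.sat L π g (n + 1) ∨
      (PLTL.sat L π f (n + 1) ∧ PLTL.sat L π (.since f g) n) := sin_step _ _ n

theorem sat_trig_succ (L : S → Set AP) (π : ℕ → S) (f g : PLTL AP) (n : ℕ) :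
    PLTL.sat L π (.trig f g) (n + 1) ↔ PLTL.sat L π g (n + 1) ∧
      (PLTL.sat L π f (n + 1) ∨ PLTL.sat L π (.trig f g) n) := tri_step _ _ n

theorem loop_complete (L : S → Set AP) (π : ℕ → S) (k l : ℕ) (hl0 : 0 < l) (hlk : l ≤ k)
    (hπ : ∀ n, l ≤ n → π (n + (k + 1 - l)) = π n) :
    ∃ aux : PLTL AP → ℕ → Prop, ∀ φ : PLTL AP,
    pevC k L π (fun i => i = l) (fun i => l ≤ i) True (VV L π l (k + 1 - l)) aux φ := by
  obtain ⟨p, hp⟩ : ∃ p, p = k + 1 - l := ⟨_, rfl⟩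
  rw [← hp] at hπ ⊢
  have hp1 : 1 ≤ p := by omega
  have hpV := pV_VV L π l p hp1 hπ
  have hloop := VV_loop L π l p hπ
  have hlast : ∀ φ, pLastC k (fun i => i = l) True (VV L π l p) φ := by
    intro φ d hd
    refine ⟨fun h => absurd trivial h, ?_⟩
    rintro i h1 h2 rfl
    rw [hpV, hloop _ _ _ (by omega), hloop _ _ _ le_rfl, Nat.add_mul,
      show k + 1 + d * p = i + (d * p + 1 * p) by omega]
  -- every late position projects to a loop position in the top unrolling
  have hproj : ∀ (g : PLTL AP) (j : ℕ), l + g.delta * p ≤ j →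
      ∃ i, l ≤ i ∧ i ≤ k ∧ (PLTL.sat L π g j ↔ VV L π l p g g.delta i) := by
    intro g j hj
    obtain ⟨i, D, h1, h2, h3⟩ := coord_ex k l hlk j
    rw [← hp] at h3
    have hi : l ≤ i := by
      rcases h1 with h | h
      · subst h; omega
      · exact h
    refine ⟨i, hi, h2, ?_⟩
    have hD : g.delta ≤ D := by
      by_contra hD
      have := Nat.mul_le_mul_right p (show D + 1 ≤ g.delta by omega)
      rw [Nat.add_mul] at this
      omega
    rw [h3, ← hloop g D i hi, ← hpV g D i, pV, min_eq_right hD]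
  refine ⟨fun φ i => match φ with
    | .untl _ g => ∃ j, l ≤ j ∧ j ≤ i ∧ VV L π l p g g.delta j
    | .rels _ g => ∀ j, l ≤ j → j ≤ i → VV L π l p g g.delta j
    | _ => True, ?_⟩
  intro φ
  induction φ with
  | atom q => exact ⟨fun i hi => by simp [VV], hlast _⟩
  | natom q => exact ⟨fun i hi => by simp [VV], hlast _⟩
  | conj f g ihf ihg =>
    exact ⟨ihf, ihg, fun d hd i hi => by simp only [hpV, VV], hlast _⟩
  | disj f g ihf ihg =>
    exact ⟨ihf, ihg, fun d hd i hi => by simp only [hpV, VV], hlast _⟩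
  | next f ihf =>
    exact ⟨ihf, fun d hd i hi => by simp only [hpV, VV], hlast _⟩
  | untl f g ihf ihg =>
    refine ⟨ihf, ihg, fun d hd i hi => ?_, hlast _, ?_, ?_, ?_⟩
    · simp only [hpV]
      exact unt_step _ _ _
    · rintro ⟨j, h1, h2, -⟩
      omega
    · intro i h1 h2
      constructor
      · rintro ⟨j, h3, h4, h5⟩
        rcases Nat.eq_or_lt_of_le h4 with h | h
        · subst h; exact Or.inr ⟨h3, h5⟩
        · exact Or.inl ⟨j, h3, by omega, h5⟩
      · rintro (⟨j, h3, h4, h5⟩ | ⟨h3, h5⟩)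
        · exact ⟨j, h3, by omega, h5⟩
        · exact ⟨i, h3, le_rfl, h5⟩
    · intro _ h
      rw [hloop _ _ _ hlk] at h
      obtain ⟨j, hj, hg, -⟩ := h
      have := Nat.mul_le_mul_right p (show g.delta ≤ (PLTL.untl f g).delta from le_max_right _ _)
      obtain ⟨i, h1, h2, h3⟩ := hproj g j (by omega)
      exact ⟨i, h1, h2, h3.1 hg⟩
  | rels f g ihf ihg =>
    refine ⟨ihf, ihg, fun d hd i hi => ?_, hlast _, ?_, ?_, ?_⟩
    · simp only [hpV]
      exact rel_step _ _ _
    · intro j h1 h2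
      omega
    · intro i h1 h2
      constructor
      · intro h
        refine ⟨fun j h3 h4 => h j h3 (by omega), ?_⟩
        by_cases hi : l ≤ i
        · exact Or.inr (h i hi le_rfl)
        · exact Or.inl hi
      · rintro ⟨h, h'⟩ j h3 h4
        rcases Nat.eq_or_lt_of_le h4 with h5 | h5
        · subst h5; exact h'.resolve_left (fun h => h h3)
        · exact h j h3 (by omega)
    · intro _ h
      rw [hloop _ _ _ hlk]
      intro j hj
      have := Nat.mul_le_mul_right p (show g.delta ≤ (PLTL.rels f g).delta from le_max_right _ _)
      obtain ⟨i, h1, h2, h3⟩ := hproj g j (by omega)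
      exact Or.inl (h3.2 (h i h1 h2))
  | prev f ihf =>
    refine ⟨ihf, fun d hd => ?_, fun i h1 h2 => ?_, fun d h0 hd i h1 h2 => ?_, hlast _⟩
    · simp [VV]; omega
    · obtain ⟨i, rfl⟩ : ∃ j, i = j + 1 := ⟨i - 1, by omega⟩
      rw [hpV, VV_zero, VV_zero, sat_prev_succ]; rfl
    · obtain ⟨i, rfl⟩ : ∃ j, i = j + 1 := ⟨i - 1, by omega⟩
      obtain ⟨d, rfl⟩ : ∃ j, d = j + 1 := ⟨d - 1, by omega⟩
      simp only [hpV, Nat.add_sub_cancel]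
      rcases Nat.lt_trichotomy (i + 1) l with h | h | h
      · simp only [VV, h, Nat.not_le.2 h, h.ne, Nat.add_sub_cancel]; simp
      · rw [hloop _ _ _ h.ge, hloop _ _ _ hlk,
          show i + 1 + (d + 1) * p = (k + d * p) + 1 by rw [Nat.add_mul]; omega, sat_prev_succ]
        simp [h]
      · rw [hloop _ _ _ h.le, hloop _ _ _ (show l ≤ i by omega), Nat.add_right_comm, sat_prev_succ]
        simp [h.ne']
  | wprev f ihf =>
    refine ⟨ihf, fun d hd => ?_, fun i h1 h2 => ?_, fun d h0 hd i h1 h2 => ?_, hlast _⟩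
    · simp [VV]; omega
    · obtain ⟨i, rfl⟩ : ∃ j, i = j + 1 := ⟨i - 1, by omega⟩
      rw [hpV, VV_zero, VV_zero, sat_wprev_succ]; rfl
    · obtain ⟨i, rfl⟩ : ∃ j, i = j + 1 := ⟨i - 1, by omega⟩
      obtain ⟨d, rfl⟩ : ∃ j, d = j + 1 := ⟨d - 1, by omega⟩
      simp only [hpV, Nat.add_sub_cancel]
      rcases Nat.lt_trichotomy (i + 1) l with h | h | h
      · simp only [VV, h, Nat.not_le.2 h, h.ne, Nat.add_sub_cancel]; simp
      · rw [hloop _ _ _ h.ge, hloop _ _ _ hlk,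
          show i + 1 + (d + 1) * p = (k + d * p) + 1 by rw [Nat.add_mul]; omega, sat_wprev_succ]
        simp [h]
      · rw [hloop _ _ _ h.le, hloop _ _ _ (show l ≤ i by omega), Nat.add_right_comm, sat_wprev_succ]
        simp [h.ne']
  | since f g ihf ihg =>
    refine ⟨ihf, ihg, fun d hd => ?_, fun i h1 h2 => ?_, fun d h0 hd i h1 h2 => ?_, hlast _⟩
    · simp [VV, hpV, sin_zero, hl0, hl0.ne']
    · obtain ⟨i, rfl⟩ : ∃ j, i = j + 1 := ⟨i - 1, by omega⟩
      rw [hpV, hpV, VV_zero, VV_zero, VV_zero, VV_zero, sat_since_succ]; rfl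
    · obtain ⟨i, rfl⟩ : ∃ j, i = j + 1 := ⟨i - 1, by omega⟩
      obtain ⟨d, rfl⟩ : ∃ j, d = j + 1 := ⟨d - 1, by omega⟩
      simp only [hpV, Nat.add_sub_cancel]
      rcases Nat.lt_trichotomy (i + 1) l with h | h | h
      · have h' : i < l := by omega
        simp only [VV, h, h', Nat.not_le.2 h, Nat.not_le.2 h', h.ne, sin_step]; simp
      · rw [hloop _ _ _ h.ge, hloop _ _ _ h.ge, hloop _ _ _ h.ge, hloop _ _ _ hlk,
          show i + 1 + (d + 1) * p = (k + d * p) + 1 by rw [Nat.add_mul]; omega, sat_since_succ]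
        simp [h]
      · rw [hloop _ _ _ h.le, hloop _ _ _ h.le, hloop _ _ _ h.le, 
          hloop _ (d + 1) _ (show l ≤ i by omega), Nat.add_right_comm, sat_since_succ]
        simp [h.ne']
  | trig f g ihf ihg =>
    refine ⟨ihf, ihg, fun d hd => ?_, fun i h1 h2 => ?_, fun d h0 hd i h1 h2 => ?_, hlast _⟩
    · simp [VV, hpV, tri_zero, hl0, hl0.ne']
    · obtain ⟨i, rfl⟩ : ∃ j, i = j + 1 := ⟨i - 1, by omega⟩
      rw [hpV, hpV, VV_zero, VV_zero, VV_zero, VV_zero, sat_trig_succ]; rfl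
    · obtain ⟨i, rfl⟩ : ∃ j, i = j + 1 := ⟨i - 1, by omega⟩
      obtain ⟨d, rfl⟩ : ∃ j, d = j + 1 := ⟨d - 1, by omega⟩
      simp only [hpV, Nat.add_sub_cancel]
      rcases Nat.lt_trichotomy (i + 1) l with h | h | h
      · have h' : i < l := by omega
        simp only [VV, h, h', Nat.not_le.2 h, Nat.not_le.2 h', h.ne, tri_step]; simp
      · rw [hloop _ _ _ h.ge, hloop _ _ _ h.ge, hloop _ _ _ h.ge, hloop _ _ _ hlk,
          show i + 1 + (d + 1) * p = (k + d * p) + 1 by rw [Nat.add_mul]; omega, sat_trig_succ]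
        simp [h]
      · rw [hloop _ _ _ h.le, hloop _ _ _ h.le, hloop _ _ _ h.le, 
          hloop _ (d + 1) _ (show l ≤ i by omega), Nat.add_right_comm, sat_trig_succ]
        simp [h.ne']

/-! ### Completeness without loops -/

theorem nl_unt_step (F G : ℕ → Prop) (k i : ℕ) (hi : i ≤ k) :
    (∃ j, i ≤ j ∧ j ≤ k ∧ G j ∧ ∀ n, i ≤ n → n < j → F n) ↔
    G i ∨ (F i ∧ (i + 1 ≤ k ∧ ∃ j, i + 1 ≤ j ∧ j ≤ k ∧ G j ∧ ∀ n, i + 1 ≤ n → n < j → F n)) := by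
  constructor
  · rintro ⟨j, hj, hk, hg, hf⟩
    rcases Nat.eq_or_lt_of_le hj with h | h
    · subst h; exact Or.inl hg
    · exact Or.inr ⟨hf i le_rfl h, by omega, j, h, hk, hg, fun n h1 h2 => hf n (by omega) h2⟩
  · rintro (h | ⟨h, -, j, hj, hk, hg, hf⟩)
    · exact ⟨i, le_rfl, hi, h, fun n h1 h2 => by omega⟩
    · refine ⟨j, by omega, hk, hg, fun n h1 h2 => ?_⟩
      rcases Nat.eq_or_lt_of_le h1 with h3 | h3
      · subst h3; exact h
      · exact hf n h3 h2

theorem nl_rel_step (F G : ℕ → Prop) (k i : ℕ) (hi : i ≤ k) :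
    (∃ j, i ≤ j ∧ j ≤ k ∧ F j ∧ ∀ n, i ≤ n → n ≤ j → G n) ↔
    G i ∧ (F i ∨ (i + 1 ≤ k ∧ ∃ j, i + 1 ≤ j ∧ j ≤ k ∧ F j ∧ ∀ n, i + 1 ≤ n → n ≤ j → G n)) := by
  constructor
  · rintro ⟨j, hj, hk, hg, hf⟩
    refine ⟨hf i le_rfl hj, ?_⟩
    rcases Nat.eq_or_lt_of_le hj with h | h
    · subst h; exact Or.inl hg
    · exact Or.inr ⟨by omega, j, h, hk, hg, fun n h1 h2 => hf n (by omega) h2⟩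
  · rintro ⟨hG, (h | ⟨-, j, hj, hk, hg, hf⟩)⟩
    · refine ⟨i, le_rfl, hi, h, fun n h1 h2 => ?_⟩
      obtain rfl : n = i := by omega
      exact hG
    · refine ⟨j, by omega, hk, hg, fun n h1 h2 => ?_⟩
      rcases Nat.eq_or_lt_of_le h1 with h3 | h3
      · subst h3; exact hG
      · exact hf n h3 h2

theorem nl_complete (L : S → Set AP) (π : ℕ → S) (k : ℕ) :
    ∃ aux : PLTL AP → ℕ → Prop, ∀ φ : PLTL AP,
    pevC k L π (fun _ => False) (fun _ => False) False
      (fun φ _ i => i ≤ k ∧ PLTL.satNL L π k φ i) aux φ := by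
  have hlast : ∀ φ, pLastC k (fun _ => False) False
      (fun φ _ i => i ≤ k ∧ PLTL.satNL L π k φ i) φ := by
    intro φ d hd
    refine ⟨fun _ h => by omega, fun i _ _ h => h.elim⟩
  refine ⟨fun φ i => match φ with
    | .untl _ _ => False
    | _ => True, ?_⟩
  intro φ
  induction φ with
  | atom q => exact ⟨fun i hi => by simp [PLTL.satNL, hi], hlast _⟩
  | natom q => exact ⟨fun i hi => by simp [PLTL.satNL, hi], hlast _⟩
  | conj f g ihf ihg =>
    exact ⟨ihf, ihg, fun d hd i hi => by simp [pV, PLTL.satNL, hi], hlast _⟩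
  | disj f g ihf ihg =>
    exact ⟨ihf, ihg, fun d hd i hi => by simp [pV, PLTL.satNL, hi], hlast _⟩
  | next f ihf =>
    exact ⟨ihf, fun d hd i hi => by simp [pV, PLTL.satNL, hi], hlast _⟩
  | untl f g ihf ihg =>
    refine ⟨ihf, ihg, fun d hd i hi => ?_, hlast _, fun h => h, fun i h1 h2 => by simp,
      fun h => h.elim⟩
    have := nl_unt_step (PLTL.satNL L π k f) (PLTL.satNL L π k g) k i hi
    simp only [pV, hi, true_and]
    exact this
  | rels f g ihf ihg =>
    refine ⟨ihf, ihg, fun d hd i hi => ?_, hlast _, trivial, fun i h1 h2 => by simp,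
      fun h => h.elim⟩
    have := nl_rel_step (PLTL.satNL L π k f) (PLTL.satNL L π k g) k i hi
    simp only [pV, hi, true_and]
    exact this
  | prev f ihf =>
    refine ⟨ihf, fun d hd => by simp [PLTL.satNL], fun i h1 h2 => ?_, fun d h0 hd i h1 h2 => ?_,
      hlast _⟩
    · have : i - 1 ≤ k := by omega
      have : 0 < i := h1
      simp [pV, PLTL.satNL, *]
    · have : i - 1 ≤ k := by omega
      have : 0 < i := h1
      simp [pV, PLTL.satNL, *]
  | wprev f ihf =>
    refine ⟨ihf, fun d hd => by simp [PLTL.satNL], fun i h1 h2 => ?_, fun d h0 hd i h1 h2 => ?_,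
      hlast _⟩
    · have : i - 1 ≤ k := by omega
      have : i ≠ 0 := by omega
      simp [pV, PLTL.satNL, *]
    · have : i - 1 ≤ k := by omega
      have : i ≠ 0 := by omega
      simp [pV, PLTL.satNL, *]
  | since f g ihf ihg =>
    have key : ∀ i, 1 ≤ i → i ≤ k → (PLTL.satNL L π k (.since f g) i ↔
        PLTL.satNL L π k g i ∨ (PLTL.satNL L π k f i ∧ PLTL.satNL L π k (.since f g) (i - 1))) := by
      intro i h1 h2
      obtain ⟨i, rfl⟩ : ∃ j, i = j + 1 := ⟨i - 1, by omega⟩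
      exact sin_step _ _ _
    refine ⟨ihf, ihg, fun d hd => ?_, fun i h1 h2 => ?_, fun d h0 hd i h1 h2 => ?_, hlast _⟩
    · simp [pV]
      exact sin_zero _ _
    · have : i - 1 ≤ k := by omega
      simp only [pV, h2, this, true_and, key i h1 h2]
    · have : i - 1 ≤ k := by omega
      simp only [pV, h2, this, true_and, key i h1 h2, false_and, not_false_eq_true, false_or]
  | trig f g ihf ihg =>
    have key : ∀ i, 1 ≤ i → i ≤ k → (PLTL.satNL L π k (.trig f g) i ↔
        PLTL.satNL L π k g i ∧ (PLTL.satNL L π k f i ∨ PLTL.satNL L π k (.trig f g) (i - 1))) := by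
      intro i h1 h2
      obtain ⟨i, rfl⟩ : ∃ j, i = j + 1 := ⟨i - 1, by omega⟩
      exact tri_step _ _ _
    refine ⟨ihf, ihg, fun d hd => ?_, fun i h1 h2 => ?_, fun d h0 hd i h1 h2 => ?_, hlast _⟩
    · simp [pV]
      exact tri_zero _ _
    · have : i - 1 ≤ k := by omega
      simp only [pV, h2, this, true_and, key i h1 h2]
    · have : i - 1 ≤ k := by omega
      simp only [pV, h2, this, true_and, key i h1 h2, false_and, not_false_eq_true, false_or]

theorem bsat_PEvSat (M : Kripke S AP) (k : ℕ) (π : ℕ → S) (hM : M.InitPath π) (ψ : PLTL AP)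
    (h : PLTL.bsat M.L π k ψ) : PEvSat M ψ k := by
  have hmod : ModelC M k π := by
    refine ⟨hM.1, fun i h1 h2 => ?_⟩
    have := hM.2 (i - 1)
    rwa [Nat.sub_add_cancel h1] at this
  rcases h with ⟨l, ⟨hl0, hlk, hs, hper⟩, hsat⟩ | h
  · obtain ⟨aux, haux⟩ := loop_complete M.L π k l hl0 hlk hper
    refine ⟨π, _, _, _, _, aux, hmod, ?_, haux ψ, (VV_zero _ _ _ _ _ _).2 hsat⟩
    refine ⟨hl0.ne, by omega, ?_, ?_, ?_, ?_⟩
    · rintro i h1 h2 rfl; exact hs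
    · intro i h1 h2; omega
    · intro i h1 h2 h3; omega
    · simp [hlk]
  · obtain ⟨aux, haux⟩ := nl_complete M.L π k
    refine ⟨π, _, _, _, _, aux, hmod, ?_, haux ψ, ⟨by omega, h⟩⟩
    simp [LoopC]

/-! ### Soundness without loops -/

theorem pevC_last (k : ℕ) (L : S → Set AP) (s : ℕ → S) (lsel inL : ℕ → Prop) (LE : Prop)
    (v : PLTL AP → ℕ → ℕ → Prop) (aux : PLTL AP → ℕ → Prop) (f : PLTL AP)
    (hf : pevC k L s lsel inL LE v aux f) : pLastC k lsel LE v f := by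
  cases f <;> simp only [pevC] at hf <;> simp only [hf]

theorem nl_sound (L : S → Set AP) (s π : ℕ → S) (k : ℕ) (hs : ∀ i, i ≤ k → π i = s i)
    (lsel inL : ℕ → Prop) (LE : Prop) (v : PLTL AP → ℕ → ℕ → Prop) (aux : PLTL AP → ℕ → Prop)
    (hLE : ¬ LE) (φ : PLTL AP) (h : pevC k L s lsel inL LE v aux φ) :
    ∀ i, i ≤ k → v φ 0 i → PLTL.sat L π φ i := by
  have p0 : ∀ φ i, pV v φ 0 i ↔ v φ 0 i := by intro φ i; simp [pV]
  have last : ∀ φ, pLastC k lsel LE v φ → ¬ v φ 0 (k + 1) :=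
    fun φ h => (h 0 (Nat.zero_le _)).1 hLE
  induction φ with
  | atom q => intro i hi hv; rw [h.1 i hi] at hv; simpa [PLTL.sat, hs i hi] using hv
  | natom q => intro i hi hv; rw [h.1 i hi] at hv; simpa [PLTL.sat, hs i hi] using hv
  | conj f g ihf ihg =>
    obtain ⟨hf, hg, h1, h2⟩ := h
    intro i hi hv
    rw [h1 0 (Nat.zero_le _) i hi, p0, p0] at hv
    exact ⟨ihf hf i hi hv.1, ihg hg i hi hv.2⟩
  | disj f g ihf ihg =>
    obtain ⟨hf, hg, h1, h2⟩ := h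
    intro i hi hv
    rw [h1 0 (Nat.zero_le _) i hi, p0, p0] at hv
    exact hv.imp (ihf hf i hi) (ihg hg i hi)
  | next f ihf =>
    obtain ⟨hf, h1, h2⟩ := h
    intro i hi hv
    rw [h1 0 (Nat.zero_le _) i hi, p0] at hv
    rcases Nat.eq_or_lt_of_le hi with h | h
    · subst h
      exact absurd hv (last f (pevC_last _ _ _ _ _ _ _ _ _ hf))
    · exact ihf hf (i + 1) h hv
  | untl f g ihf ihg =>
    obtain ⟨hf, hg, h1, h2, -⟩ := h
    have key : ∀ m i, i + m = k + 1 → v (.untl f g) 0 i →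
        Unt (PLTL.sat L π f) (PLTL.sat L π g) i := by
      intro m
      induction m with
      | zero => intro i hi hv; obtain rfl : i = k + 1 := hi; exact absurd hv (last _ h2)
      | succ m ih =>
        intro i hi hv
        rw [h1 0 (Nat.zero_le _) i (by omega), p0, p0] at hv
        rw [unt_step]
        exact hv.imp (ihg hg i (by omega))
          (fun h => ⟨ihf hf i (by omega) h.1, ih (i + 1) (by omega) h.2⟩)
    intro i hi hv
    exact key (k + 1 - i) i (by omega) hv
  | rels f g ihf ihg =>
    obtain ⟨hf, hg, h1, h2, -⟩ := h
    have key : ∀ m i, i + m = k + 1 → v (.rels f g) 0 i →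
        Rel (PLTL.sat L π f) (PLTL.sat L π g) i := by
      intro m
      induction m with
      | zero => intro i hi hv; obtain rfl : i = k + 1 := hi; exact absurd hv (last _ h2)
      | succ m ih =>
        intro i hi hv
        rw [h1 0 (Nat.zero_le _) i (by omega), p0, p0] at hv
        rw [rel_step]
        exact ⟨ihg hg i (by omega) hv.1, hv.2.imp (ihf hf i (by omega)) (ih (i + 1) (by omega))⟩
    intro i hi hv
    exact key (k + 1 - i) i (by omega) hv
  | prev f ihf =>
    obtain ⟨hf, h0, h1, -⟩ := h
    intro i hi hv
    rcases Nat.eq_zero_or_pos i with h | h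
    · subst h; exact absurd hv (h0 0 (Nat.zero_le _))
    · rw [h1 i h hi, p0] at hv
      exact ⟨h, ihf hf _ (by omega) hv⟩
  | wprev f ihf =>
    obtain ⟨hf, h0, h1, -⟩ := h
    intro i hi hv
    rcases Nat.eq_zero_or_pos i with h | h
    · exact Or.inl h
    · rw [h1 i h hi, p0] at hv
      exact Or.inr (ihf hf _ (by omega) hv)
  | since f g ihf ihg =>
    obtain ⟨hf, hg, h0, h1, -⟩ := h
    intro i
    induction i with
    | zero =>
      intro hi hv
      rw [h0 0 (Nat.zero_le _), p0] at hv
      exact (sin_zero _ _).2 (ihg hg 0 hi hv)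
    | succ i ih =>
      intro hi hv
      rw [h1 (i + 1) (by omega) hi, p0, p0] at hv
      rw [sat_since_succ]
      exact hv.imp (ihg hg _ hi) (fun h => ⟨ihf hf _ hi h.1, ih (by omega) h.2⟩)
  | trig f g ihf ihg =>
    obtain ⟨hf, hg, h0, h1, -⟩ := h
    intro i
    induction i with
    | zero =>
      intro hi hv
      rw [h0 0 (Nat.zero_le _), p0] at hv
      exact (tri_zero _ _).2 (ihg hg 0 hi hv)
    | succ i ih =>
      intro hi hv
      rw [h1 (i + 1) (by omega) hi, p0, p0] at hv
      rw [sat_trig_succ]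
      exact ⟨ihg hg _ hi hv.1, hv.2.imp (ihf hf _ hi) (ih (by omega))⟩

/-! ### Soundness with loops -/

theorem loop_sound (L : S → Set AP) (s : ℕ → S) (k l : ℕ) (hl1 : 1 ≤ l) (hlk : l ≤ k)
    (lsel inL : ℕ → Prop) (LE : Prop) (v : PLTL AP → ℕ → ℕ → Prop) (aux : PLTL AP → ℕ → Prop)
    (hl : ∀ i, 1 ≤ i → i ≤ k → (lsel i ↔ i = l))
    (hin : ∀ i, 1 ≤ i → i ≤ k → (inL i ↔ l ≤ i)) (hLE : LE)
    (φ : PLTL AP) (h : pevC k L s lsel inL LE v aux φ) :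
    ∀ n, pV v φ (dd k l n) (ii k l n) ↔ PLTL.sat L (fun n => s (ii k l n)) φ n := by
  obtain ⟨π, hπ⟩ : ∃ π, π = fun n => s (ii k l n) := ⟨_, rfl⟩
  rw [← hπ]
  have hper : ∀ n, l ≤ n → π (n + (k + 1 - l)) = π n := by
    intro n hn
    simp only [hπ]
    rw [(coord_per k l hlk n hn).2]
  have hi : ∀ n, ii k l n ≤ k := fun n => (coord_spec k l hlk n).2.1
  have hsmall := coord_small k l hlk
  have hnext : ∀ φ, pLastC k lsel LE v φ → ∀ n,
      (v φ (min (dd k l n) φ.delta) (ii k l n + 1) ↔ pV v φ (dd k l (n + 1)) (ii k l (n + 1))) := by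
    intro φ hφ n
    rcases coord_succ k l hlk n with ⟨h1, h2, h3⟩ | ⟨h1, h2, h3⟩
    · rw [h2, h3, pV]
    · rw [h1, h2, h3, (hφ (min (dd k l n) φ.delta) (min_le_right _ _)).2 l hl1 hlk
        ((hl l hl1 hlk).2 rfl), pV, pV,
        show min (min (dd k l n) φ.delta + 1) φ.delta = min (dd k l n + 1) φ.delta by omega]
  have pmin : ∀ (f : PLTL AP) d m i, f.delta ≤ m → (pV v f (min d m) i ↔ pV v f d i) := by
    intro f d m i hm
    rw [pV, pV, show min (min d m) f.delta = min d f.delta by omega]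
  -- the top unrolling is seen at all late positions
  have htop : ∀ (f : PLTL AP) i D, l ≤ i → i ≤ k → f.delta ≤ D →
      (pV v f (dd k l (i + D * (k + 1 - l))) (ii k l (i + D * (k + 1 - l))) ↔ v f f.delta i) := by
    intro f i D h1 h2 h3
    obtain ⟨h4, h5⟩ := coord_mk k l i D (Or.inr h1) h2 hlk
    rw [h4, h5, pV, min_eq_right h3]
  -- not selecting at a non-wrapping step of a positive unrolling
  have hnsel : ∀ n, ii k l n < k → 1 ≤ dd k l n → ¬ lsel (ii k l n + 1) := by
    intro n h1 h2 h3
    rw [hl _ (by omega) (by omega)] at h3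
    rcases (coord_spec k l hlk n).1 with h | h <;> omega
  have hsell : lsel l := (hl l hl1 hlk).2 rfl
  -- extension by periodicity for formulas with a past operator on top
  have hext : ∀ (φ : PLTL AP),
      (∀ n, n < l + (φ.delta + 1) * (k + 1 - l) →
        (pV v φ (dd k l n) (ii k l n) ↔ PLTL.sat L π φ n)) →
      ∀ n, pV v φ (dd k l n) (ii k l n) ↔ PLTL.sat L π φ n := by
    intro φ hφ n
    induction n using Nat.strong_induction_on with
    | _ n ih =>
      by_cases hn : n < l + (φ.delta + 1) * (k + 1 - l)
      · exact hφ n hn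
      · rw [Nat.add_mul, Nat.one_mul] at hn
        obtain ⟨m, rfl⟩ : ∃ m, n = m + (k + 1 - l) := ⟨n - (k + 1 - l), by omega⟩
        have hm : l ≤ m := by omega
        rw [sat_per L π l (k + 1 - l) (by omega) hper φ m (by omega), ← ih m (by omega),
          (coord_per k l hlk m hm).1, (coord_per k l hlk m hm).2]
        have hd : φ.delta ≤ dd k l m := by
          obtain ⟨h1, h2, h3⟩ := coord_spec k l hlk m
          by_contra hD
          have := Nat.mul_le_mul_right (k + 1 - l) (show dd k l m + 1 ≤ φ.delta by omega)
          rw [Nat.add_mul] at this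
          omega
        rw [pV, pV, min_eq_right hd, min_eq_right (by omega)]
  have hdd : ∀ D n, n < l + (D + 1) * (k + 1 - l) → dd k l n ≤ D := by
    intro D n hn
    obtain ⟨h1, h2, h3⟩ := coord_spec k l hlk n
    by_contra hD
    have h4 : l ≤ ii k l n := by omega
    have := Nat.mul_le_mul_right (k + 1 - l) (show D + 1 ≤ dd k l n by omega)
    omega
  induction φ with
  | atom q =>
    intro n
    simp only [pV, PLTL.delta, Nat.min_zero, PLTL.sat, h.1 _ (hi n), hπ]
  | natom q =>
    intro n
    simp only [pV, PLTL.delta, Nat.min_zero, PLTL.sat, h.1 _ (hi n), hπ]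
  | conj f g ihf ihg =>
    obtain ⟨hf, hg, h1, -⟩ := h
    intro n
    rw [pV, h1 _ (min_le_right _ _) _ (hi n), pmin f _ (PLTL.conj f g).delta _ (le_max_left _ _),
      pmin g _ (PLTL.conj f g).delta _ (le_max_right _ _), ihf hf, ihg hg]
    rfl
  | disj f g ihf ihg =>
    obtain ⟨hf, hg, h1, -⟩ := h
    intro n
    rw [pV, h1 _ (min_le_right _ _) _ (hi n), pmin f _ (PLTL.disj f g).delta _ (le_max_left _ _),
      pmin g _ (PLTL.disj f g).delta _ (le_max_right _ _), ihf hf, ihg hg]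
    rfl
  | next f ihf =>
    obtain ⟨hf, h1, -⟩ := h
    intro n
    rw [pV, h1 _ (min_le_right _ _) _ (hi n), pmin f _ (PLTL.next f).delta _ le_rfl, pV,
      hnext f (pevC_last _ _ _ _ _ _ _ _ _ hf), ihf hf]
    rfl
  | untl f g ihf ihg =>
    obtain ⟨hf, hg, h1, hlast, hx0, hx, hxk⟩ := h
    replace ihf := ihf hf
    replace ihg := ihg hg
    have hδ : g.delta ≤ (PLTL.untl f g).delta := le_max_right _ _
    have step : ∀ n, pV v (.untl f g) (dd k l n) (ii k l n) ↔ PLTL.sat L π g n ∨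
        (PLTL.sat L π f n ∧ pV v (.untl f g) (dd k l (n + 1)) (ii k l (n + 1))) := by
      intro n
      rw [← hnext _ hlast, pV, h1 _ (min_le_right _ _) _ (hi n), pmin f _ (PLTL.untl f g).delta _ (le_max_left _ _),
        pmin g _ (PLTL.untl f g).delta _ (le_max_right _ _), ihf, ihg]
    refine unt_char _ _ _ step ?_
    intro n hn
    by_contra hcon
    push Not at hcon
    have hall : ∀ m, pV v (.untl f g) (dd k l (n + m)) (ii k l (n + m)) := by
      intro m
      induction m with
      | zero => exact hn
      | succ m ih =>
        rcases (step _).1 ih with h | h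
        · exact absurd h (hcon _ (by omega))
        · exact h.2
    have hbig : n ≤ (n + (PLTL.untl f g).delta) * (k + 1 - l) :=
      le_trans (by omega) (Nat.le_mul_of_pos_right (n + (PLTL.untl f g).delta)
        (show 0 < k + 1 - l by omega))
    have hU := hall (k + (n + (PLTL.untl f g).delta) * (k + 1 - l) - n)
    rw [Nat.add_sub_cancel' (by omega), htop _ _ _ hlk le_rfl (by omega)] at hU
    have haux : ∀ i, i ≤ k → aux (.untl f g) i → ∃ j, l ≤ j ∧ j ≤ k ∧ v g g.delta j := by
      intro i
      induction i with
      | zero => intro _ h; exact absurd h hx0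
      | succ i ih =>
        intro hi h
        rw [hx (i + 1) (by omega) hi, hin _ (by omega) hi] at h
        rcases h with h | h
        · exact ih (by omega) h
        · exact ⟨i + 1, h.1, hi, h.2⟩
    obtain ⟨j, hj1, hj2, hj3⟩ := haux k le_rfl (hxk hLE hU)
    rw [← htop g j (n + (PLTL.untl f g).delta) hj1 hj2 (by omega), ihg] at hj3
    exact hcon _ (by omega) hj3
  | rels f g ihf ihg =>
    obtain ⟨hf, hg, h1, hlast, hx0, hx, hxk⟩ := h
    replace ihf := ihf hf
    replace ihg := ihg hg
    have hδ : g.delta ≤ (PLTL.rels f g).delta := le_max_right _ _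
    have step : ∀ n, pV v (.rels f g) (dd k l n) (ii k l n) ↔ PLTL.sat L π g n ∧
        (PLTL.sat L π f n ∨ pV v (.rels f g) (dd k l (n + 1)) (ii k l (n + 1))) := by
      intro n
      rw [← hnext _ hlast, pV, h1 _ (min_le_right _ _) _ (hi n), pmin f _ (PLTL.rels f g).delta _ (le_max_left _ _),
        pmin g _ (PLTL.rels f g).delta _ (le_max_right _ _), ihf, ihg]
    refine rel_char _ _ _ step ?_
    intro n hn
    by_contra hcon
    push Not at hcon
    have hall : ∀ m, ¬ pV v (.rels f g) (dd k l (n + m)) (ii k l (n + m)) := by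
      intro m
      induction m with
      | zero => exact hn
      | succ m ih =>
        intro h
        exact ih ((step _).2 ⟨hcon _ (by omega), Or.inr h⟩)
    have hbig : n ≤ (n + (PLTL.rels f g).delta) * (k + 1 - l) :=
      le_trans (by omega) (Nat.le_mul_of_pos_right (n + (PLTL.rels f g).delta)
        (show 0 < k + 1 - l by omega))
    have hU := hall (k + (n + (PLTL.rels f g).delta) * (k + 1 - l) - n)
    rw [Nat.add_sub_cancel' (by omega), htop _ _ _ hlk le_rfl (by omega)] at hU
    have haux : ∀ i, i ≤ k → aux (.rels f g) i := by
      intro i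
      induction i with
      | zero => intro _; exact hx0
      | succ i ih =>
        intro hi
        rw [hx (i + 1) (by omega) hi, hin _ (by omega) hi]
        refine ⟨ih (by omega), ?_⟩
        by_cases hli : l ≤ i + 1
        · right
          rw [← htop g (i + 1) (n + (PLTL.rels f g).delta) hli hi (by omega), ihg]
          exact hcon _ (by omega)
        · exact Or.inl hli
    exact hU (hxk hLE (haux k le_rfl))
  | prev f ihf =>
    obtain ⟨hf, h0, h1, h2, -⟩ := h
    replace ihf := ihf hf
    intro n
    cases n with
    | zero =>
      rw [(hsmall 0 (by omega)).1, (hsmall 0 (by omega)).2, pV]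
      simp [PLTL.sat, h0]
    | succ n =>
      rw [sat_prev_succ, ← ihf]
      rcases coord_succ k l hlk n with ⟨h3, h4, h5⟩ | ⟨h3, h4, h5⟩
      · rw [h4, h5]
        rcases Nat.eq_zero_or_pos (dd k l n) with hd | hd
        · rw [hd, pV, Nat.zero_min, h1 _ (by omega) (by omega), Nat.add_sub_cancel]
        · have := hnsel n h3 hd
          rw [pV, h2 _ (by simp only [PLTL.delta]; omega) (min_le_right _ _) _ (by omega) (by omega),
            Nat.add_sub_cancel, pmin f _ (PLTL.prev f).delta _ (Nat.le_succ _)]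
          tauto
      · rw [h4, h5, h3, pV, h2 _ (by simp only [PLTL.delta]; omega) (min_le_right _ _) _ hl1 hlk,
          show min (dd k l n + 1) (PLTL.prev f).delta - 1 = min (dd k l n) f.delta by
            simp only [PLTL.delta]; omega, pmin f _ f.delta _ le_rfl]
        tauto
  | wprev f ihf =>
    obtain ⟨hf, h0, h1, h2, -⟩ := h
    replace ihf := ihf hf
    intro n
    cases n with
    | zero =>
      rw [(hsmall 0 (by omega)).1, (hsmall 0 (by omega)).2, pV]
      simp [PLTL.sat, h0]
    | succ n =>
      rw [sat_wprev_succ, ← ihf]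
      rcases coord_succ k l hlk n with ⟨h3, h4, h5⟩ | ⟨h3, h4, h5⟩
      · rw [h4, h5]
        rcases Nat.eq_zero_or_pos (dd k l n) with hd | hd
        · rw [hd, pV, Nat.zero_min, h1 _ (by omega) (by omega), Nat.add_sub_cancel]
        · have := hnsel n h3 hd
          rw [pV, h2 _ (by simp only [PLTL.delta]; omega) (min_le_right _ _) _ (by omega) (by omega),
            Nat.add_sub_cancel, pmin f _ (PLTL.wprev f).delta _ (Nat.le_succ _)]
          tauto
      · rw [h4, h5, h3, pV, h2 _ (by simp only [PLTL.delta]; omega) (min_le_right _ _) _ hl1 hlk,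
          show min (dd k l n + 1) (PLTL.wprev f).delta - 1 = min (dd k l n) f.delta by
            simp only [PLTL.delta]; omega, pmin f _ f.delta _ le_rfl]
        tauto
  | since f g ihf ihg =>
    obtain ⟨hf, hg, h0, h1, h2, -⟩ := h
    replace ihf := ihf hf
    replace ihg := ihg hg
    have hδ : (PLTL.since f g).delta = max f.delta g.delta + 1 := rfl
    have hpvs : ∀ d i, pV v (.since f g) d i = v (.since f g) (min d (PLTL.since f g).delta) i :=
      fun _ _ => rfl
    apply hext
    refine sin_char _ _ _ _ ?_ ?_
    · rw [← ihg, (hsmall 0 (by omega)).1, (hsmall 0 (by omega)).2, pV, Nat.zero_min,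
        h0 _ (by omega)]
    · intro n hn
      have hD := hdd _ _ hn
      rw [← ihg, ← ihf]
      rcases coord_succ k l hlk n with ⟨h3, h4, h5⟩ | ⟨h3, h4, h5⟩
      · rw [h4] at hD
        rw [h4, h5]
        simp only [hpvs]
        rw [min_eq_left hD]
        rcases Nat.eq_zero_or_pos (dd k l n) with hd | hd
        · rw [hd, h1 _ (by omega) (by omega), Nat.add_sub_cancel]
        · have := hnsel n h3 hd
          rw [h2 _ hd hD _ (by omega) (by omega), Nat.add_sub_cancel]
          simp only [this, false_and, not_false_eq_true, true_and, false_or]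
      · rw [h4] at hD
        rw [h4, h5, h3]
        simp only [hpvs]
        rw [min_eq_left hD, h2 _ (by omega) hD _ hl1 hlk, Nat.add_sub_cancel,
          min_eq_left (by omega)]
        simp only [hsell, true_and, not_true_eq_false, false_and, or_false]
  | trig f g ihf ihg =>
    obtain ⟨hf, hg, h0, h1, h2, -⟩ := h
    replace ihf := ihf hf
    replace ihg := ihg hg
    have hδ : (PLTL.trig f g).delta = max f.delta g.delta + 1 := rfl
    have hpvs : ∀ d i, pV v (.trig f g) d i = v (.trig f g) (min d (PLTL.trig f g).delta) i :=
      fun _ _ => rfl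
    apply hext
    refine tri_char _ _ _ _ ?_ ?_
    · rw [← ihg, (hsmall 0 (by omega)).1, (hsmall 0 (by omega)).2, pV, Nat.zero_min,
        h0 _ (by omega)]
    · intro n hn
      have hD := hdd _ _ hn
      rw [← ihg, ← ihf]
      rcases coord_succ k l hlk n with ⟨h3, h4, h5⟩ | ⟨h3, h4, h5⟩
      · rw [h4] at hD
        rw [h4, h5]
        simp only [hpvs]
        rw [min_eq_left hD]
        rcases Nat.eq_zero_or_pos (dd k l n) with hd | hd
        · rw [hd, h1 _ (by omega) (by omega), Nat.add_sub_cancel]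
        · have := hnsel n h3 hd
          rw [h2 _ hd hD _ (by omega) (by omega), Nat.add_sub_cancel]
          simp only [this, false_and, not_false_eq_true, true_and, false_or]
      · rw [h4] at hD
        rw [h4, h5, h3]
        simp only [hpvs]
        rw [min_eq_left hD, h2 _ (by omega) hD _ hl1 hlk, Nat.add_sub_cancel,
          min_eq_left (by omega)]
        simp only [hsell, true_and, not_true_eq_false, false_and, or_false]

theorem PEvSat_sat (M : Kripke S AP) (hTot : M.Total) (ψ : PLTL AP) (k : ℕ)
    (h : PEvSat M ψ k) : ∃ π : ℕ → S, M.InitPath π ∧ PLTL.sat M.L π ψ 0 := by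
  obtain ⟨s, lsel, inL, LE, v, aux, ⟨hI, hT⟩, ⟨hs0, hi0, hsel, hinL, huniq, hLE⟩, hev, hv⟩ := h
  by_cases hLE' : LE
  · have hmono : ∀ m i, i + m ≤ k → inL i → inL (i + m) := by
      intro m i
      induction m with
      | zero => intro _ h; exact h
      | succ m ih =>
        intro h1 h2
        rw [← Nat.add_assoc, hinL _ (by omega) (by omega)]
        exact Or.inl (ih (by omega) h2)
    have hmin : ∃ i, inL i := ⟨k, hLE.1 hLE'⟩
    classical
    obtain ⟨l, hl, hlmin⟩ : ∃ l, inL l ∧ ∀ m, m < l → ¬ inL m :=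
      ⟨Nat.find hmin, Nat.find_spec hmin, fun m hm => Nat.find_min hmin hm⟩
    have hl1 : 1 ≤ l := by
      rcases Nat.eq_zero_or_pos l with h | h
      · subst h; exact absurd hl hi0
      · exact h
    have hlk : l ≤ k := by
      by_contra h
      exact hlmin k (by omega) (hLE.1 hLE')
    have hin : ∀ i, 1 ≤ i → i ≤ k → (inL i ↔ l ≤ i) := by
      intro i h1 h2
      constructor
      · intro h
        by_contra hc
        exact hlmin i (by omega) h
      · intro h
        have := hmono (i - l) l (by omega) hl
        rwa [Nat.add_sub_cancel' h] at this
    have hls : ∀ i, 1 ≤ i → i ≤ k → (lsel i ↔ i = l) := by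
      intro i h1 h2
      constructor
      · intro h
        have h3 : l ≤ i := (hin i h1 h2).1 ((hinL i h1 h2).2 (Or.inr h))
        by_contra hc
        exact huniq i h1 h2 ((hin (i - 1) (by omega) (by omega)).2 (by omega)) h
      · rintro rfl
        rcases (hinL i h1 h2).1 hl with h | h
        · exact absurd h (hlmin _ (by omega))
        · exact h
    refine ⟨fun n => s (ii k l n), ⟨?_, ?_⟩, ?_⟩
    · show M.I (s (ii k l 0))
      rw [(coord_small k l hlk 0 (by omega)).2]; exact hI
    · intro n
      rcases coord_succ k l hlk n with ⟨h3, h4, h5⟩ | ⟨h3, h4, h5⟩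
      · have := hT (ii k l n + 1) (by omega) (by omega)
        simpa [h5] using this
      · have h6 := hT l hl1 hlk
        rw [hsel l hl1 hlk ((hls l hl1 hlk).2 rfl)] at h6
        simpa [h3, h5] using h6
    · rw [← loop_sound M.L s k l hl1 hlk lsel inL LE v aux hls hin hLE' ψ hev,
        (coord_small k l hlk 0 (by omega)).1, (coord_small k l hlk 0 (by omega)).2, pV, Nat.zero_min]
      exact hv
  · choose nx hnx using hTot
    let π : ℕ → S := fun n => if n ≤ k then s n else nx^[n - k] (s k)
    have hπ : ∀ i, i ≤ k → π i = s i := fun i hi => by simp [π, hi]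
    refine ⟨π, ⟨?_, ?_⟩, nl_sound M.L s π k hπ lsel inL LE v aux hLE' ψ hev 0 (by omega) hv⟩
    · rw [hπ 0 (by omega)]; exact hI
    · intro i
      by_cases hi : i + 1 ≤ k
      · rw [hπ i (by omega), hπ _ hi]
        exact hT (i + 1) (by omega) hi
      · have e1 : π i = nx^[i - k] (s k) := by
          by_cases hik : i ≤ k
          · obtain rfl : i = k := by omega
            simp [π]
          · simp [π, hik]
        have e2 : π (i + 1) = nx (π i) := by
          rw [e1, ← Function.iterate_succ_apply' nx]
          simp only [π, hi, if_false]
          rw [show (i - k).succ = i + 1 - k by omega]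
        rw [e2]
        exact hnx _

/-! ### Extraction of a lasso -/

def sub : PLTL AP → Set (PLTL AP)
  | .atom p => {.atom p}
  | .natom p => {.natom p}
  | .conj f g => {.conj f g} ∪ (sub f ∪ sub g)
  | .disj f g => {.disj f g} ∪ (sub f ∪ sub g)
  | .next f => {.next f} ∪ sub f
  | .untl f g => {.untl f g} ∪ (sub f ∪ sub g)
  | .rels f g => {.rels f g} ∪ (sub f ∪ sub g)
  | .prev f => {.prev f} ∪ sub f
  | .wprev f => {.wprev f} ∪ sub f
  | .since f g => {.since f g} ∪ (sub f ∪ sub g)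
  | .trig f g => {.trig f g} ∪ (sub f ∪ sub g)

theorem sub_finite (φ : PLTL AP) : (sub φ).Finite := by
  induction φ with
  | atom q => exact Set.finite_singleton _
  | natom q => exact Set.finite_singleton _
  | next f ih => exact (Set.finite_singleton _).union ih
  | prev f ih => exact (Set.finite_singleton _).union ih
  | wprev f ih => exact (Set.finite_singleton _).union ih
  | conj f g ih1 ih2 => exact (Set.finite_singleton _).union (ih1.union ih2)
  | disj f g ih1 ih2 => exact (Set.finite_singleton _).union (ih1.union ih2)
  | untl f g ih1 ih2 => exact (Set.finite_singleton _).union (ih1.union ih2)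
  | rels f g ih1 ih2 => exact (Set.finite_singleton _).union (ih1.union ih2)
  | since f g ih1 ih2 => exact (Set.finite_singleton _).union (ih1.union ih2)
  | trig f g ih1 ih2 => exact (Set.finite_singleton _).union (ih1.union ih2)

theorem self_mem_sub (φ : PLTL AP) : φ ∈ sub φ := by
  cases φ <;> simp [sub]

theorem lasso_sat (L : S → Set AP) (π : ℕ → S) (a b : ℕ) (hab : a < b) (C : Set (PLTL AP))
    (h1 : ∀ φ ∈ C, (PLTL.sat L π φ a ↔ PLTL.sat L π φ b))
    (h2 : ∀ f g, PLTL.untl f g ∈ C → PLTL.sat L π (.untl f g) a →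
      ∃ j, a ≤ j ∧ j ≤ b ∧ PLTL.sat L π g j)
    (h3 : ∀ f g, PLTL.rels f g ∈ C → ¬ PLTL.sat L π (.rels f g) a →
      ∃ j, a ≤ j ∧ j ≤ b ∧ ¬ PLTL.sat L π g j)
    (φ : PLTL AP) (hφ : sub φ ⊆ C) :
    ∀ n, PLTL.sat L π φ (ii b (a + 1) n) ↔
      PLTL.sat L (fun n => π (ii b (a + 1) n)) φ n := by
  have hlk : a + 1 ≤ b := hab
  obtain ⟨ρ, hρ⟩ : ∃ ρ, ρ = fun n => π (ii b (a + 1) n) := ⟨_, rfl⟩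
  rw [← hρ]
  have hsucc : ∀ φ ∈ C, ∀ n, ∃ m, ii b (a + 1) (n + 1) = m + 1 ∧
      (PLTL.sat L π φ m ↔ PLTL.sat L π φ (ii b (a + 1) n)) := by
    intro φ hφ n
    rcases coord_succ b (a + 1) hlk n with ⟨h4, h5, h6⟩ | ⟨h4, h5, h6⟩
    · exact ⟨_, h6, Iff.rfl⟩
    · exact ⟨a, h6, by rw [h4, h1 φ hφ]⟩
  have hnext : ∀ n, ∀ φ, PLTL.next φ ∈ C → (PLTL.sat L π φ (ii b (a + 1) n + 1) ↔
      PLTL.sat L π φ (ii b (a + 1) (n + 1))) := by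
    intro n φ hφ
    obtain ⟨m, hm, h⟩ := hsucc _ hφ n
    rw [hm]
    exact h.symm
  have hzero : ii b (a + 1) 0 = 0 := (coord_small b (a + 1) hlk 0 (by omega)).2
  -- all of the loop is visited after any position
  have hvisit : ∀ n j, a + 1 ≤ j → j ≤ b → ∃ m, n ≤ m ∧ ii b (a + 1) m = j := by
    intro n j hj1 hj2
    refine ⟨j + n * (b + 1 - (a + 1)), ?_, (coord_mk b (a + 1) j n (Or.inr hj1) hj2 hlk).2⟩
    have := Nat.le_mul_of_pos_right n (show 0 < b + 1 - (a + 1) by omega)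
    omega
  -- one step in the future
  have hstep : ∀ (φ : PLTL AP) (_ : φ ∈ C) (P : ℕ → Prop → Prop)
      (_ : ∀ m, PLTL.sat L π φ m ↔ P m (PLTL.sat L π φ (m + 1)))
      (_ : P a = P b), ∀ n, PLTL.sat L π φ (ii b (a + 1) n) ↔
        P (ii b (a + 1) n) (PLTL.sat L π φ (ii b (a + 1) (n + 1))) := by
    intro φ hφ P hP hab n
    rcases coord_succ b (a + 1) hlk n with ⟨h4, h5, h6⟩ | ⟨h4, h5, h6⟩
    · rw [h6]; exact hP _
    · rw [h6, h4, ← h1 φ hφ, ← hab]; exact hP _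
  induction φ with
  | atom q => intro n; simp only [PLTL.sat, hρ]
  | natom q => intro n; simp only [PLTL.sat, hρ]
  | conj f g ihf ihg =>
    simp only [sub, Set.union_subset_iff] at hφ
    intro n
    simp only [PLTL.sat, ← ihf hφ.2.1, ← ihg hφ.2.2]
  | disj f g ihf ihg =>
    simp only [sub, Set.union_subset_iff] at hφ
    intro n
    simp only [PLTL.sat, ← ihf hφ.2.1, ← ihg hφ.2.2]
  | next f ihf =>
    have hm := hφ (self_mem_sub _)
    simp only [sub, Set.union_subset_iff] at hφ
    intro n
    simp only [PLTL.sat, ← ihf hφ.2]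
    exact hnext n f hm
  | untl f g ihf ihg =>
    have hm := hφ (self_mem_sub _)
    simp only [sub, Set.union_subset_iff] at hφ
    replace ihf := ihf hφ.2.1
    replace ihg := ihg hφ.2.2
    have hfC := hφ.2.1 (self_mem_sub _)
    have hgC := hφ.2.2 (self_mem_sub _)
    have step := hstep (.untl f g) hm
      (fun m A => PLTL.sat L π g m ∨ (PLTL.sat L π f m ∧ A)) (fun m => unt_step _ _ m)
      (by simp only [h1 f hfC, h1 g hgC])
    simp only [ihf, ihg] at step
    refine unt_char _ _ _ step ?_
    intro n hn
    by_contra hcon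
    push Not at hcon
    have hall : ∀ m, PLTL.sat L π (.untl f g) (ii b (a + 1) (n + m)) := by
      intro m
      induction m with
      | zero => exact hn
      | succ m ih =>
        rcases (step _).1 ih with h | h
        · exact absurd h (hcon _ (by omega))
        · exact h.2
    obtain ⟨m, hm1, hm2⟩ := hvisit n b hlk le_rfl
    have hU := hall (m - n)
    rw [Nat.add_sub_cancel' hm1, hm2, ← h1 _ hm] at hU
    obtain ⟨j, hj1, hj2, hj3⟩ := h2 f g hm hU
    rcases Nat.eq_or_lt_of_le hj1 with h | h
    · subst h
      rw [h1 _ hgC, ← hm2, ihg] at hj3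
      exact hcon m hm1 hj3
    · obtain ⟨m', hm1', hm2'⟩ := hvisit n j h hj2
      rw [← hm2', ihg] at hj3
      exact hcon m' hm1' hj3
  | rels f g ihf ihg =>
    have hm := hφ (self_mem_sub _)
    simp only [sub, Set.union_subset_iff] at hφ
    replace ihf := ihf hφ.2.1
    replace ihg := ihg hφ.2.2
    have hfC := hφ.2.1 (self_mem_sub _)
    have hgC := hφ.2.2 (self_mem_sub _)
    have step := hstep (.rels f g) hm
      (fun m A => PLTL.sat L π g m ∧ (PLTL.sat L π f m ∨ A)) (fun m => rel_step _ _ m)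
      (by simp only [h1 f hfC, h1 g hgC])
    simp only [ihf, ihg] at step
    refine rel_char _ _ _ step ?_
    intro n hn
    by_contra hcon
    push Not at hcon
    have hall : ∀ m, ¬ PLTL.sat L π (.rels f g) (ii b (a + 1) (n + m)) := by
      intro m
      induction m with
      | zero => exact hn
      | succ m ih =>
        intro h
        exact ih ((step _).2 ⟨hcon _ (by omega), Or.inr h⟩)
    obtain ⟨m, hm1, hm2⟩ := hvisit n b hlk le_rfl
    have hU := hall (m - n)
    rw [Nat.add_sub_cancel' hm1, hm2, ← h1 _ hm] at hU
    obtain ⟨j, hj1, hj2, hj3⟩ := h3 f g hm hU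
    rcases Nat.eq_or_lt_of_le hj1 with h | h
    · subst h
      rw [h1 _ hgC, ← hm2, ihg] at hj3
      exact hj3 (hcon m hm1)
    · obtain ⟨m', hm1', hm2'⟩ := hvisit n j h hj2
      rw [← hm2', ihg] at hj3
      exact hj3 (hcon m' hm1')
  | prev f ihf =>
    simp only [sub, Set.union_subset_iff] at hφ
    replace ihf := ihf hφ.2
    have hfC := hφ.2 (self_mem_sub _)
    intro n
    cases n with
    | zero => rw [hzero]; simp [PLTL.sat]
    | succ n =>
      obtain ⟨m, hm, h⟩ := hsucc f hfC n
      rw [hm, sat_prev_succ, sat_prev_succ, h, ihf]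
  | wprev f ihf =>
    simp only [sub, Set.union_subset_iff] at hφ
    replace ihf := ihf hφ.2
    have hfC := hφ.2 (self_mem_sub _)
    intro n
    cases n with
    | zero => rw [hzero]; simp [PLTL.sat]
    | succ n =>
      obtain ⟨m, hm, h⟩ := hsucc f hfC n
      rw [hm, sat_wprev_succ, sat_wprev_succ, h, ihf]
  | since f g ihf ihg =>
    have hmC := hφ (self_mem_sub _)
    simp only [sub, Set.union_subset_iff] at hφ
    replace ihf := ihf hφ.2.1
    replace ihg := ihg hφ.2.2
    intro n
    refine sin_char (PLTL.sat L ρ f) (PLTL.sat L ρ g)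
      (fun n => PLTL.sat L π (.since f g) (ii b (a + 1) n)) (n + 1) ?_ ?_ n (by omega)
    · beta_reduce
      rw [← ihg, hzero]
      exact sin_zero _ _
    · intro n _
      obtain ⟨m, hm, h⟩ := hsucc _ hmC n
      beta_reduce
      rw [← ihf, ← ihg, ← h, hm]
      exact sin_step _ _ _
  | trig f g ihf ihg =>
    have hmC := hφ (self_mem_sub _)
    simp only [sub, Set.union_subset_iff] at hφ
    replace ihf := ihf hφ.2.1
    replace ihg := ihg hφ.2.2
    intro n
    refine tri_char (PLTL.sat L ρ f) (PLTL.sat L ρ g)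
      (fun n => PLTL.sat L π (.trig f g) (ii b (a + 1) n)) (n + 1) ?_ ?_ n (by omega)
    · beta_reduce
      rw [← ihg, hzero]
      exact tri_zero _ _
    · intro n _
      obtain ⟨m, hm, h⟩ := hsucc _ hmC n
      beta_reduce
      rw [← ihf, ← ihg, ← h, hm]
      exact tri_step _ _ _

theorem sat_PEvSat [Finite S] (M : Kripke S AP) (ψ : PLTL AP) (π : ℕ → S) (hπ : M.InitPath π)
    (hsat : PLTL.sat M.L π ψ 0) : ∃ k, PEvSat M ψ k := by
  have hfin : Finite (sub ψ) := sub_finite ψ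
  let col : ℕ → S × (sub ψ → Prop) := fun n => (π n, fun φ => PLTL.sat M.L π φ.1 n)
  obtain ⟨c, hc⟩ := Finite.exists_infinite_fiber col
  have hinf : (col ⁻¹' {c}).Infinite := Set.infinite_coe_iff.1 hc
  obtain ⟨a, ha⟩ := hinf.nonempty
  have hB : ∀ φ : PLTL AP, ∃ B,
      (∀ f g, φ = .untl f g → PLTL.sat M.L π (.untl f g) a →
        ∃ j, a ≤ j ∧ j ≤ B ∧ PLTL.sat M.L π g j) ∧
      (∀ f g, φ = .rels f g → ¬ PLTL.sat M.L π (.rels f g) a →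
        ∃ j, a ≤ j ∧ j ≤ B ∧ ¬ PLTL.sat M.L π g j) := by
    intro φ
    by_cases hu : ∃ f g, φ = .untl f g ∧ PLTL.sat M.L π (.untl f g) a
    · obtain ⟨f, g, rfl, j, hj, hg, -⟩ := hu
      refine ⟨j, ?_, ?_⟩
      · rintro f' g' h -
        cases h
        exact ⟨j, hj, le_rfl, hg⟩
      · rintro f' g' h -
        cases h
    · by_cases hr : ∃ f g, φ = .rels f g ∧ ¬ PLTL.sat M.L π (.rels f g) a
      · obtain ⟨f, g, rfl, hr⟩ := hr
        have : ∃ j, a ≤ j ∧ ¬ PLTL.sat M.L π g j := by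
          by_contra hcon
          push Not at hcon
          exact hr fun j hj => Or.inl (hcon j hj)
        obtain ⟨j, hj, hg⟩ := this
        refine ⟨j, ?_, ?_⟩
        · rintro f' g' h -
          cases h
        · rintro f' g' h -
          cases h
          exact ⟨j, hj, le_rfl, hg⟩
      · exact ⟨0, fun f g h h' => absurd ⟨f, g, h, h'⟩ hu, fun f g h h' => absurd ⟨f, g, h, h'⟩ hr⟩
  choose B hB1 hB2 using hB
  obtain ⟨N, hN⟩ := ((sub_finite ψ).image B).bddAbove
  have hN' : ∀ φ ∈ sub ψ, B φ ≤ N := fun φ hφ => hN (Set.mem_image_of_mem B hφ)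
  obtain ⟨b, hb, hbN⟩ := hinf.exists_gt (max a N)
  have hab : a < b := lt_of_le_of_lt (le_max_left _ _) hbN
  have hNb : N ≤ b := (lt_of_le_of_lt (le_max_right _ _) hbN).le
  have hcol : col a = col b := by
    rw [show col a = c from ha, show col b = c from hb]
  have hst : π a = π b := congrArg Prod.fst hcol
  have hty : ∀ φ ∈ sub ψ, (PLTL.sat M.L π φ a ↔ PLTL.sat M.L π φ b) := fun φ hφ =>
    iff_of_eq (congrFun (congrArg Prod.snd hcol) ⟨φ, hφ⟩)
  have key := lasso_sat M.L π a b hab (sub ψ) hty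
    (fun f g hm hs => by
      obtain ⟨j, h1, h2, h3⟩ := hB1 _ f g rfl hs
      exact ⟨j, h1, h2.trans ((hN' _ hm).trans hNb), h3⟩)
    (fun f g hm hs => by
      obtain ⟨j, h1, h2, h3⟩ := hB2 _ f g rfl hs
      exact ⟨j, h1, h2.trans ((hN' _ hm).trans hNb), h3⟩) ψ subset_rfl 0
  have hlk : a + 1 ≤ b := hab
  have hsm := coord_small b (a + 1) hlk
  rw [(hsm 0 (by omega)).2] at key
  refine ⟨b, bsat_PEvSat M b _ ⟨?_, ?_⟩ ψ (Or.inl ⟨a + 1, ⟨by omega, hlk, ?_, ?_⟩, key.1 hsat⟩)⟩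
  · show M.I (π (ii b (a + 1) 0))
    rw [(hsm 0 (by omega)).2]; exact hπ.1
  · intro n
    show M.T (π (ii b (a + 1) n)) (π (ii b (a + 1) (n + 1)))
    rcases coord_succ b (a + 1) hlk n with ⟨h4, h5, h6⟩ | ⟨h4, h5, h6⟩
    · rw [h6]; exact hπ.2 _
    · rw [h6, h4, ← hst]; exact hπ.2 _
  · show π (ii b (a + 1) (a + 1 - 1)) = π (ii b (a + 1) b)
    rw [(hsm b le_rfl).2, (hsm (a + 1 - 1) (by omega)).2]; exact hst
  · intro n hn
    show π (ii b (a + 1) _) = π (ii b (a + 1) n)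
    rw [(coord_per b (a + 1) hlk n hn).2]

end

end BMC

open BMC in
/-- Theorem (PLTL eventuality encoding): `M` has an initialised path
satisfying the PLTL formula `ψ` iff the PLTL eventuality encoding is
satisfiable for some bound `k`; in particular `π ⊨_k ψ` for an initialised
path `π` implies the encoding at `k` is satisfiable. -/
theorem pltl_eventuality_encoding_correct {S AP : Type} [Finite S]
    (M : Kripke S AP) (hTot : M.Total) (ψ : PLTL AP) :
    ((∃ π : ℕ → S, M.InitPath π ∧ PLTL.sat M.L π ψ 0) ↔ ∃ k : ℕ, PEvSat M ψ k) ∧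
    (∀ (k : ℕ) (π : ℕ → S), M.InitPath π → PLTL.bsat M.L π k ψ → PEvSat M ψ k) := by
  exact ⟨⟨fun ⟨π, hπ, hs⟩ => sat_PEvSat M ψ π hπ hs,
    fun ⟨k, hk⟩ => PEvSat_sat M hTot ψ k hk⟩, fun k π hπ hb => bsat_PEvSat M k π hπ ψ hb⟩
end

section
/- Let ψ be a PLTL formula and let B^ψ be the tight symbolic Büchi automaton obtained from the tableau-style automaton by virtual unrolling up to past operator depth δ(ψ). Then the language of B^ψ is exactly the set of infinite words satisfying ψ: L(B^ψ) = {α ∈ (2^AP)^ω | α ⊨ ψ}. -/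
namespace BMC

variable {AP : Type}

/-- A state of the symbolic Büchi automaton `B^ψ`: the state variables
`⟦φ⟧^d` for the subformulas `φ` of `ψ` and unrollings `d ≤ δ(φ)`, plus the
oracles `InLoop` and `le`. -/
structure BASt (AP : Type) where
  val : PLTL AP → ℕ → Prop
  inLoop : Prop
  le : Prop

/-- Lookup of `⟦φ⟧^d` in a state, with the convention
`⟦φ⟧^d = ⟦φ⟧^{δ(φ)}` for `d > δ(φ)`. -/
def bv (x : BASt AP) (φ : PLTL AP) (d : ℕ) : Prop := x.val φ (min d φ.delta)

/-- Componentwise state constraints for Boolean operators (and consistency of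
the literals), generated recursively for all subformulas. -/
def baStC (x : BASt AP) : PLTL AP → Prop
  | .atom _ => True
  | .natom p => bv x (.natom p) 0 ↔ ¬ bv x (.atom p) 0
  | .conj f g => baStC x f ∧ baStC x g ∧
      (∀ d, d ≤ (PLTL.conj f g).delta →
        (x.val (.conj f g) d ↔ (bv x f d ∧ bv x g d)))
  | .disj f g => baStC x f ∧ baStC x g ∧
      (∀ d, d ≤ (PLTL.disj f g).delta →
        (x.val (.disj f g) d ↔ (bv x f d ∨ bv x g d)))
  | .next f => baStC x f
  | .untl f g => baStC x f ∧ baStC x g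
  | .rels f g => baStC x f ∧ baStC x g
  | .prev f => baStC x f
  | .wprev f => baStC x f
  | .since f g => baStC x f ∧ baStC x g
  | .trig f g => baStC x f ∧ baStC x g

/-- The state invariant of `B^ψ`: `le ⇒ InLoop` and the Boolean constraints. -/
def baState (ψ : PLTL AP) (x : BASt AP) : Prop :=
  (x.le → x.inLoop) ∧ baStC x ψ

/-- Initialisation of the past operators at unrolling `0`, generated
recursively for all subformulas. -/
def baInitC (x : BASt AP) : PLTL AP → Prop
  | .atom _ => True
  | .natom _ => True
  | .conj f g => baInitC x f ∧ baInitC x g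
  | .disj f g => baInitC x f ∧ baInitC x g
  | .next f => baInitC x f
  | .untl f g => baInitC x f ∧ baInitC x g
  | .rels f g => baInitC x f ∧ baInitC x g
  | .prev f => baInitC x f ∧ ¬ x.val (.prev f) 0
  | .wprev f => baInitC x f ∧ x.val (.wprev f) 0
  | .since f g => baInitC x f ∧ baInitC x g ∧
      (x.val (.since f g) 0 ↔ bv x g 0)
  | .trig f g => baInitC x f ∧ baInitC x g ∧
      (x.val (.trig f g) 0 ↔ bv x g 0)

/-- Initial states of `B^ψ`: the state invariant, the initialisation of the
past operators, and the initial state constraint `⟦ψ⟧^0`. -/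
def baInit (ψ : PLTL AP) (x : BASt AP) : Prop :=
  baState ψ x ∧ baInitC x ψ ∧ bv x ψ 0

/-- The transition constraints of `B^ψ` for the temporal operators, generated
recursively for all subformulas: within a loop iteration and on the stem
(`¬le` and not entering the loop at an unrolling `d > 0`) the one-step
current/next-state characterisations hold at each unrolling, and on
transitions with `le` unrolling `d` is linked to unrolling
`min(d+1, δ(φ))`. -/
def baTrC (x y : BASt AP) : PLTL AP → Prop
  | .atom _ => True
  | .natom _ => True
  | .conj f g => baTrC x y f ∧ baTrC x y g
  | .disj f g => baTrC x y f ∧ baTrC x y g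
  | .next f => baTrC x y f ∧
      (∀ d, d ≤ (PLTL.next f).delta →
        ((¬ x.le ∧ ¬ (¬ x.inLoop ∧ y.inLoop ∧ 0 < d)) →
          (x.val (.next f) d ↔ bv y f d)) ∧
        (x.le → (x.val (.next f) d ↔ bv y f (d + 1))))
  | .untl f g => baTrC x y f ∧ baTrC x y g ∧
      (∀ d, d ≤ (PLTL.untl f g).delta →
        ((¬ x.le ∧ ¬ (¬ x.inLoop ∧ y.inLoop ∧ 0 < d)) →
          (x.val (.untl f g) d ↔
            (bv x g d ∨ (bv x f d ∧ bv y (.untl f g) d)))) ∧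
        (x.le → (x.val (.untl f g) d ↔
            (bv x g d ∨ (bv x f d ∧ bv y (.untl f g) (d + 1))))))
  | .rels f g => baTrC x y f ∧ baTrC x y g ∧
      (∀ d, d ≤ (PLTL.rels f g).delta →
        ((¬ x.le ∧ ¬ (¬ x.inLoop ∧ y.inLoop ∧ 0 < d)) →
          (x.val (.rels f g) d ↔
            (bv x g d ∧ (bv x f d ∨ bv y (.rels f g) d)))) ∧
        (x.le → (x.val (.rels f g) d ↔
            (bv x g d ∧ (bv x f d ∨ bv y (.rels f g) (d + 1))))))
  | .prev f => baTrC x y f ∧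
      (∀ d, d ≤ (PLTL.prev f).delta →
        ((¬ x.le ∧ ¬ (¬ x.inLoop ∧ y.inLoop ∧ 0 < d)) →
          (y.val (.prev f) d ↔ bv x f d)) ∧
        (x.le → (bv y (.prev f) (d + 1) ↔ bv x f d)))
  | .wprev f => baTrC x y f ∧
      (∀ d, d ≤ (PLTL.wprev f).delta →
        ((¬ x.le ∧ ¬ (¬ x.inLoop ∧ y.inLoop ∧ 0 < d)) →
          (y.val (.wprev f) d ↔ bv x f d)) ∧
        (x.le → (bv y (.wprev f) (d + 1) ↔ bv x f d)))
  | .since f g => baTrC x y f ∧ baTrC x y g ∧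
      (∀ d, d ≤ (PLTL.since f g).delta →
        ((¬ x.le ∧ ¬ (¬ x.inLoop ∧ y.inLoop ∧ 0 < d)) →
          (y.val (.since f g) d ↔
            (bv y g d ∨ (bv y f d ∧ x.val (.since f g) d)))) ∧
        (x.le → (bv y (.since f g) (d + 1) ↔
            (bv y g (d + 1) ∨ (bv y f (d + 1) ∧ x.val (.since f g) d)))))
  | .trig f g => baTrC x y f ∧ baTrC x y g ∧
      (∀ d, d ≤ (PLTL.trig f g).delta →
        ((¬ x.le ∧ ¬ (¬ x.inLoop ∧ y.inLoop ∧ 0 < d)) →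
          (y.val (.trig f g) d ↔
            (bv y g d ∧ (bv y f d ∨ x.val (.trig f g) d)))) ∧
        (x.le → (bv y (.trig f g) (d + 1) ↔
            (bv y g (d + 1) ∧ (bv y f (d + 1) ∨ x.val (.trig f g) d)))))

/-- Transitions of `B^ψ`: both states satisfy the invariant, `InLoop` is
monotone, and the temporal transition constraints hold. -/
def baTrans (ψ : PLTL AP) (x y : BASt AP) : Prop :=
  baState ψ x ∧ baState ψ y ∧ (x.inLoop → y.inLoop) ∧ baTrC x y ψ

/-- `ρ` is a run of `B^ψ` on the infinite word `α` over `2^AP`: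
an initialised path whose labelling (the atoms true at unrolling 0)
is exactly `α`. -/
def baRunOn (ψ : PLTL AP) (ρ : ℕ → BASt AP) (α : ℕ → Set AP) : Prop :=
  baInit ψ (ρ 0) ∧
  (∀ i, baTrans ψ (ρ i) (ρ (i + 1))) ∧
  (∀ i, ∀ p : AP, ((ρ i).val (.atom p) 0 ↔ p ∈ α i))

/-- `φ` is a subformula of `ψ`. -/
def PLTL.Subf (φ ψ : PLTL AP) : Prop :=
  φ ∈ (PLTL.rec (motive := fun _ => List (PLTL AP))
    (fun p => [.atom p]) (fun p => [.natom p])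
    (fun f g lf lg => .conj f g :: (lf ++ lg))
    (fun f g lf lg => .disj f g :: (lf ++ lg))
    (fun f lf => .next f :: lf)
    (fun f g lf lg => .untl f g :: (lf ++ lg))
    (fun f g lf lg => .rels f g :: (lf ++ lg))
    (fun f lf => .prev f :: lf)
    (fun f lf => .wprev f :: lf)
    (fun f g lf lg => .since f g :: (lf ++ lg))
    (fun f g lf lg => .trig f g :: (lf ++ lg)) ψ)

/-- The run `ρ` is accepting: every acceptance set of `B^ψ` — one for each
until subformula (`¬⟦ψ1Uψ2⟧^δ ∨ ⟦ψ2⟧^δ`), one for each release subformula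
(`⟦ψ1Rψ2⟧^δ ∨ ¬⟦ψ2⟧^δ`), and the set `{le}` — is visited infinitely often. -/
def baAccepting (ψ : PLTL AP) (ρ : ℕ → BASt AP) : Prop :=
  (∀ f g : PLTL AP, (PLTL.untl f g).Subf ψ →
    ∀ N, ∃ i, N ≤ i ∧
      (¬ bv (ρ i) (.untl f g) (PLTL.untl f g).delta ∨
        bv (ρ i) g (PLTL.untl f g).delta)) ∧
  (∀ f g : PLTL AP, (PLTL.rels f g).Subf ψ →
    ∀ N, ∃ i, N ≤ i ∧
      (bv (ρ i) (.rels f g) (PLTL.rels f g).delta ∨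
        ¬ bv (ρ i) g (PLTL.rels f g).delta)) ∧
  (∀ N, ∃ i, N ≤ i ∧ (ρ i).le)

/-- The language of `B^ψ`. -/
def baLang (ψ : PLTL AP) (α : ℕ → Set AP) : Prop :=
  ∃ ρ : ℕ → BASt AP, baRunOn ψ ρ α ∧ baAccepting ψ ρ

/-- `α ⊨ ψ`: satisfaction of `ψ` on the infinite word `α` over `2^AP`. -/
def wordSat (α : ℕ → Set AP) (ψ : PLTL AP) : Prop :=
  PLTL.sat (S := Set AP) id α ψ 0

end BMC
namespace BMC

theorem bvMin {AP : Type} (x : BASt AP) (φ : PLTL AP) (d M : ℕ) (h : φ.delta ≤ M) :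
    bv x φ (min d M) = bv x φ d := by
  unfold bv; congr 1; omega

theorem bvMinS {AP : Type} (x : BASt AP) (φ : PLTL AP) (d M : ℕ) (h : φ.delta ≤ M) :
    bv x φ (min d M + 1) = bv x φ (d + 1) := by
  unfold bv; congr 1; omega

theorem valMin {AP : Type} (x : BASt AP) (φ : PLTL AP) (d : ℕ) :
    x.val φ (min d φ.delta) = bv x φ d := rfl

theorem untlLem (V F G : ℕ → Prop) (hs : ∀ i, V i ↔ (G i ∨ (F i ∧ V (i + 1))))
    (hf : ∀ N, ∃ i, N ≤ i ∧ (¬ V i ∨ G i)) (i : ℕ) :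
    V i ↔ ∃ j, i ≤ j ∧ G j ∧ ∀ n, i ≤ n → n < j → F n := by
  constructor
  · intro hV
    by_contra hc
    push Not at hc
    have key : ∀ k, V (i + k) ∧ ∀ n, i ≤ n → n < i + k → F n := by
      intro k
      induction k with
      | zero => exact ⟨hV, fun n h1 h2 => by omega⟩
      | succ k ih =>
        obtain ⟨h1, h2⟩ := ih
        rcases (hs _).1 h1 with h | ⟨h, h'⟩
        · obtain ⟨n, a, b, c⟩ := hc (i + k) (by omega) h
          exact absurd (h2 n a b) c
        · refine ⟨h', fun n a b => ?_⟩
          by_cases hn : n = i + k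
          · rw [hn]; exact h
          · exact h2 n a (by omega)
    obtain ⟨j, hj, hj'⟩ := hf i
    obtain ⟨k, rfl⟩ := Nat.exists_eq_add_of_le hj
    rcases hj' with h | h
    · exact h (key k).1
    · obtain ⟨n, a, b, c⟩ := hc (i + k) (by omega) h
      exact absurd ((key k).2 n a b) c
  · rintro ⟨j, hj, hG, hF⟩
    obtain ⟨k, rfl⟩ := Nat.exists_eq_add_of_le hj
    clear hj
    induction k generalizing i with
    | zero => exact (hs i).2 (Or.inl hG)
    | succ k ih =>
      refine (hs i).2 (Or.inr ⟨hF i le_rfl (by omega), ih (i + 1) ?_ ?_⟩)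
      · rwa [show i + 1 + k = i + (k + 1) by omega]
      · intro n a b; exact hF n (by omega) (by omega)

theorem relsLem (V F G : ℕ → Prop) (hs : ∀ i, V i ↔ (G i ∧ (F i ∨ V (i + 1))))
    (hf : ∀ N, ∃ i, N ≤ i ∧ (V i ∨ ¬ G i)) (i : ℕ) :
    V i ↔ ∀ j, i ≤ j → (G j ∨ ∃ n, i ≤ n ∧ n < j ∧ F n) := by
  have h := untlLem (fun i => ¬ V i) (fun i => ¬ F i) (fun i => ¬ G i)
    (by intro i; have := hs i; tauto)
    (by intro N; obtain ⟨i, h, h'⟩ := hf N; exact ⟨i, h, by tauto⟩) i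
  rw [← not_iff_not, h]
  push Not
  rfl

theorem sinceLem (V F G : ℕ → Prop) (h0 : V 0 ↔ G 0)
    (hs : ∀ i, V (i + 1) ↔ (G (i + 1) ∨ (F (i + 1) ∧ V i))) (i : ℕ) :
    V i ↔ ∃ j, j ≤ i ∧ G j ∧ ∀ n, j < n → n ≤ i → F n := by
  induction i with
  | zero =>
    rw [h0]
    constructor
    · intro h; exact ⟨0, le_rfl, h, fun n a b => by omega⟩
    · rintro ⟨j, a, b, c⟩
      obtain rfl : j = 0 := by omega
      exact b
  | succ i ih =>
    rw [hs, ih]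
    constructor
    · rintro (h | ⟨h, j, a, b, c⟩)
      · exact ⟨i + 1, le_rfl, h, fun n a b => by omega⟩
      · refine ⟨j, by omega, b, fun n d e => ?_⟩
        by_cases hn : n = i + 1
        · rw [hn]; exact h
        · exact c n d (by omega)
    · rintro ⟨j, a, b, c⟩
      by_cases hj : j = i + 1
      · left; rw [← hj]; exact b
      · right
        exact ⟨c _ (by omega) le_rfl, j, by omega, b, fun n d e => c n d (by omega)⟩

theorem trigLem (V F G : ℕ → Prop) (h0 : V 0 ↔ G 0)
    (hs : ∀ i, V (i + 1) ↔ (G (i + 1) ∧ (F (i + 1) ∨ V i))) (i : ℕ) :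
    V i ↔ ∀ j, j ≤ i → (G j ∨ ∃ n, j < n ∧ n ≤ i ∧ F n) := by
  have h := sinceLem (fun i => ¬ V i) (fun i => ¬ F i) (fun i => ¬ G i) (by tauto)
    (by intro i; have := hs i; tauto) i
  rw [← not_iff_not, h]
  push Not
  rfl

def accFor {AP : Type} (ψ : PLTL AP) (ρ : ℕ → BASt AP) : Prop :=
  (∀ f g : PLTL AP, (PLTL.untl f g).Subf ψ →
    ∀ N, ∃ i, N ≤ i ∧
      (¬ bv (ρ i) (.untl f g) (PLTL.untl f g).delta ∨
        bv (ρ i) g (PLTL.untl f g).delta)) ∧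
  (∀ f g : PLTL AP, (PLTL.rels f g).Subf ψ →
    ∀ N, ∃ i, N ≤ i ∧
      (bv (ρ i) (.rels f g) (PLTL.rels f g).delta ∨
        ¬ bv (ρ i) g (PLTL.rels f g).delta))

theorem accFor.mono {AP : Type} {φ ψ : PLTL AP} {ρ : ℕ → BASt AP} (h : accFor ψ ρ)
    (hm : ∀ χ : PLTL AP, χ.Subf φ → χ.Subf ψ) : accFor φ ρ :=
  ⟨fun f g hs => h.1 f g (hm _ hs), fun f g hs => h.2 f g (hm _ hs)⟩

theorem mainLem {AP : Type} (α : ℕ → Set AP) (ρ : ℕ → BASt AP) (D : ℕ → ℕ)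
    (hat : ∀ i, ∀ p : AP, ((ρ i).val (.atom p) 0 ↔ p ∈ α i))
    (hD0 : D 0 = 0) (hD1 : ∀ i, (ρ i).le → D (i + 1) = D i + 1)
    (hD2 : ∀ i, ¬ (ρ i).le → D (i + 1) = D i)
    (hg : ∀ i, 0 < D i → (ρ i).inLoop)
    (hinf : ∀ m, ∃ N, ∀ i, N ≤ i → m ≤ D i)
    (φ : PLTL AP) (hst : ∀ i, baStC (ρ i) φ) (htr : ∀ i, baTrC (ρ i) (ρ (i + 1)) φ)
    (hin : baInitC (ρ 0) φ) (hacc : accFor φ ρ) :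
    ∀ i, bv (ρ i) φ (D i) ↔ PLTL.sat (S := Set AP) id α φ i := by
  have guard : ∀ i M, ¬ (¬ (ρ i).inLoop ∧ (ρ (i + 1)).inLoop ∧ 0 < min (D i) M) := by
    rintro i M ⟨h1, -, h2⟩
    exact h1 (hg i (by omega))
  have big : ∀ (χ : PLTL AP) (M d : ℕ) (x : BASt AP), χ.delta ≤ M → M ≤ d →
      bv x χ d = bv x χ M := by
    intro χ M d x h1 h2
    unfold bv; congr 1; omega
  induction φ with
  | atom p => intro i; simpa [bv, PLTL.delta, PLTL.sat] using hat i p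
  | natom p =>
    intro i
    have h1 := hst i
    have h2 := hat i p
    simp only [baStC, bv, PLTL.delta, PLTL.sat, Nat.min_zero, id] at *
    rw [h1, h2]
  | conj f g ihf ihg =>
    intro i
    have h1 := ihf (fun i => (hst i).1) (fun i => (htr i).1) hin.1
      (hacc.mono fun χ h => List.mem_cons_of_mem _ (List.mem_append_left _ h)) i
    have h2 := ihg (fun i => (hst i).2.1) (fun i => (htr i).2) hin.2
      (hacc.mono fun χ h => List.mem_cons_of_mem _ (List.mem_append_right _ h)) i
    have h := (hst i).2.2 (min (D i) _) (min_le_right _ _)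
    rw [valMin, bvMin _ f _ _ (by simp [PLTL.delta]), bvMin _ g _ _ (by simp [PLTL.delta])] at h
    rw [h, h1, h2]; rfl
  | disj f g ihf ihg =>
    intro i
    have h1 := ihf (fun i => (hst i).1) (fun i => (htr i).1) hin.1
      (hacc.mono fun χ h => List.mem_cons_of_mem _ (List.mem_append_left _ h)) i
    have h2 := ihg (fun i => (hst i).2.1) (fun i => (htr i).2) hin.2
      (hacc.mono fun χ h => List.mem_cons_of_mem _ (List.mem_append_right _ h)) i
    have h := (hst i).2.2 (min (D i) _) (min_le_right _ _)
    rw [valMin, bvMin _ f _ _ (by simp [PLTL.delta]), bvMin _ g _ _ (by simp [PLTL.delta])] at h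
    rw [h, h1, h2]; rfl
  | next f ihf =>
    have h1 := ihf (fun i => hst i) (fun i => (htr i).1) hin
      (hacc.mono fun χ h => List.mem_cons_of_mem _ h)
    intro i
    have h := (htr i).2 (min (D i) _) (min_le_right _ _)
    rw [valMin, bvMin _ f _ _ (by simp [PLTL.delta]), bvMinS _ f _ _ (by simp [PLTL.delta])] at h
    change _ ↔ PLTL.sat (S := Set AP) id α f (i + 1)
    rw [← h1]
    by_cases hle : (ρ i).le
    · rw [hD1 i hle]; exact h.2 hle
    · rw [hD2 i hle]; exact h.1 ⟨hle, guard _ _⟩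
  | untl f g ihf ihg =>
    have h1 := ihf (fun i => (hst i).1) (fun i => (htr i).1) hin.1
      (hacc.mono fun χ h => List.mem_cons_of_mem _ (List.mem_append_left _ h))
    have h2 := ihg (fun i => (hst i).2) (fun i => (htr i).2.1) hin.2
      (hacc.mono fun χ h => List.mem_cons_of_mem _ (List.mem_append_right _ h))
    refine untlLem (fun i => bv (ρ i) (.untl f g) (D i)) _ _ ?_ ?_
    · intro i
      have h := (htr i).2.2 (min (D i) _) (min_le_right _ _)
      simp only [valMin, bvMin _ f _ _ (show f.delta ≤ (PLTL.untl f g).delta by simp [PLTL.delta]),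
        bvMin _ g _ _ (show g.delta ≤ (PLTL.untl f g).delta by simp [PLTL.delta]),
        bvMin _ _ _ _ (le_refl (PLTL.untl f g).delta),
        bvMinS _ _ _ _ (le_refl (PLTL.untl f g).delta)] at h
      beta_reduce
      rw [← h1, ← h2]
      by_cases hle : (ρ i).le
      · rw [hD1 i hle]; exact h.2 hle
      · rw [hD2 i hle]; exact h.1 ⟨hle, guard _ _⟩
    · intro N
      obtain ⟨N', hN'⟩ := hinf (PLTL.untl f g).delta
      obtain ⟨i, hi, h⟩ := hacc.1 f g (List.mem_cons_self) (max N N')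
      refine ⟨i, by omega, ?_⟩
      beta_reduce
      rw [← h2, big _ _ _ _ le_rfl (hN' i (by omega)),
        big g _ _ _ (by simp [PLTL.delta]) (hN' i (by omega))]
      exact h
  | rels f g ihf ihg =>
    have h1 := ihf (fun i => (hst i).1) (fun i => (htr i).1) hin.1
      (hacc.mono fun χ h => List.mem_cons_of_mem _ (List.mem_append_left _ h))
    have h2 := ihg (fun i => (hst i).2) (fun i => (htr i).2.1) hin.2
      (hacc.mono fun χ h => List.mem_cons_of_mem _ (List.mem_append_right _ h))
    refine relsLem (fun i => bv (ρ i) (.rels f g) (D i)) _ _ ?_ ?_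
    · intro i
      have h := (htr i).2.2 (min (D i) _) (min_le_right _ _)
      simp only [valMin, bvMin _ f _ _ (show f.delta ≤ (PLTL.rels f g).delta by simp [PLTL.delta]),
        bvMin _ g _ _ (show g.delta ≤ (PLTL.rels f g).delta by simp [PLTL.delta]),
        bvMin _ _ _ _ (le_refl (PLTL.rels f g).delta),
        bvMinS _ _ _ _ (le_refl (PLTL.rels f g).delta)] at h
      beta_reduce
      rw [← h1, ← h2]
      by_cases hle : (ρ i).le
      · rw [hD1 i hle]; exact h.2 hle
      · rw [hD2 i hle]; exact h.1 ⟨hle, guard _ _⟩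
    · intro N
      obtain ⟨N', hN'⟩ := hinf (PLTL.rels f g).delta
      obtain ⟨i, hi, h⟩ := hacc.2 f g (List.mem_cons_self) (max N N')
      refine ⟨i, by omega, ?_⟩
      beta_reduce
      rw [← h2, big _ _ _ _ le_rfl (hN' i (by omega)),
        big g _ _ _ (by simp [PLTL.delta]) (hN' i (by omega))]
      exact h
  | prev f ihf =>
    have h1 := ihf (fun i => hst i) (fun i => (htr i).1) hin.1
      (hacc.mono fun χ h => List.mem_cons_of_mem _ h)
    intro i
    cases i with
    | zero =>
      have := hin.2
      simpa [bv, hD0, PLTL.sat] using this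
    | succ i =>
      have h := (htr i).2 (min (D i) _) (min_le_right _ _)
      simp only [valMin, bvMin _ f _ _ (show f.delta ≤ (PLTL.prev f).delta by simp [PLTL.delta]),
        bvMinS _ _ _ _ (le_refl (PLTL.prev f).delta)] at h
      simp only [PLTL.sat, Nat.add_sub_cancel, Nat.succ_pos, true_and]
      rw [← h1]
      by_cases hle : (ρ i).le
      · rw [hD1 i hle]; exact h.2 hle
      · rw [hD2 i hle]; exact h.1 ⟨hle, guard _ _⟩
  | wprev f ihf =>
    have h1 := ihf (fun i => hst i) (fun i => (htr i).1) hin.1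
      (hacc.mono fun χ h => List.mem_cons_of_mem _ h)
    intro i
    cases i with
    | zero =>
      have := hin.2
      simpa [bv, hD0, PLTL.sat] using this
    | succ i =>
      have h := (htr i).2 (min (D i) _) (min_le_right _ _)
      simp only [valMin, bvMin _ f _ _ (show f.delta ≤ (PLTL.wprev f).delta by simp [PLTL.delta]),
        bvMinS _ _ _ _ (le_refl (PLTL.wprev f).delta)] at h
      simp only [PLTL.sat, Nat.add_sub_cancel, Nat.succ_ne_zero, false_or]
      rw [← h1]
      by_cases hle : (ρ i).le
      · rw [hD1 i hle]; exact h.2 hle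
      · rw [hD2 i hle]; exact h.1 ⟨hle, guard _ _⟩
  | since f g ihf ihg =>
    have h1 := ihf (fun i => (hst i).1) (fun i => (htr i).1) hin.1
      (hacc.mono fun χ h => List.mem_cons_of_mem _ (List.mem_append_left _ h))
    have h2 := ihg (fun i => (hst i).2) (fun i => (htr i).2.1) hin.2.1
      (hacc.mono fun χ h => List.mem_cons_of_mem _ (List.mem_append_right _ h))
    refine sinceLem (fun i => bv (ρ i) (.since f g) (D i)) _ _ ?_ ?_
    · have := hin.2.2
      beta_reduce
      rw [← h2, hD0, ← this]; simp [bv]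
    · intro i
      have h := (htr i).2.2 (min (D i) _) (min_le_right _ _)
      have ef : f.delta ≤ (PLTL.since f g).delta := by simp only [PLTL.delta]; omega
      have eg : g.delta ≤ (PLTL.since f g).delta := by simp only [PLTL.delta]; omega
      simp only [valMin, bvMin _ f _ _ ef, bvMin _ g _ _ eg, bvMinS _ f _ _ ef, bvMinS _ g _ _ eg,
        bvMinS _ _ _ _ (le_refl (PLTL.since f g).delta)] at h
      beta_reduce
      rw [← h1, ← h2]
      by_cases hle : (ρ i).le
      · rw [hD1 i hle]; exact h.2 hle
      · rw [hD2 i hle]; exact h.1 ⟨hle, guard _ _⟩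
  | trig f g ihf ihg =>
    have h1 := ihf (fun i => (hst i).1) (fun i => (htr i).1) hin.1
      (hacc.mono fun χ h => List.mem_cons_of_mem _ (List.mem_append_left _ h))
    have h2 := ihg (fun i => (hst i).2) (fun i => (htr i).2.1) hin.2.1
      (hacc.mono fun χ h => List.mem_cons_of_mem _ (List.mem_append_right _ h))
    refine trigLem (fun i => bv (ρ i) (.trig f g) (D i)) _ _ ?_ ?_
    · have := hin.2.2
      beta_reduce
      rw [← h2, hD0, ← this]; simp [bv]
    · intro i
      have h := (htr i).2.2 (min (D i) _) (min_le_right _ _)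
      have ef : f.delta ≤ (PLTL.trig f g).delta := by simp only [PLTL.delta]; omega
      have eg : g.delta ≤ (PLTL.trig f g).delta := by simp only [PLTL.delta]; omega
      simp only [valMin, bvMin _ f _ _ ef, bvMin _ g _ _ eg, bvMinS _ f _ _ ef, bvMinS _ g _ _ eg,
        bvMinS _ _ _ _ (le_refl (PLTL.trig f g).delta)] at h
      beta_reduce
      rw [← h1, ← h2]
      by_cases hle : (ρ i).le
      · rw [hD1 i hle]; exact h.2 hle
      · rw [hD2 i hle]; exact h.1 ⟨hle, guard _ _⟩

theorem sound {AP : Type} (ψ : PLTL AP) (α : ℕ → Set AP) (h : baLang ψ α) : wordSat α ψ := by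
  classical
  obtain ⟨ρ, ⟨hi, ht, hat⟩, ha1, ha2, ha3⟩ := h
  let D : ℕ → ℕ := fun n => Nat.rec 0 (fun i d => if (ρ i).le then d + 1 else d) n
  have hD1 : ∀ i, (ρ i).le → D (i + 1) = D i + 1 := fun i h => if_pos h
  have hD2 : ∀ i, ¬ (ρ i).le → D (i + 1) = D i := fun i h => if_neg h
  have hD0 : D 0 = 0 := rfl
  clear_value D
  have hmono : Monotone D := monotone_nat_of_le_succ fun i => by
    by_cases h : (ρ i).le
    · rw [hD1 i h]; omega
    · rw [hD2 i h]
  have hg : ∀ i, 0 < D i → (ρ i).inLoop := by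
    intro i
    induction i with
    | zero => intro h; omega
    | succ i ih =>
      intro h
      apply (ht i).2.2.1
      by_cases hl : (ρ i).le
      · exact (ht i).1.1 hl
      · rw [hD2 i hl] at h; exact ih h
  have hinf : ∀ m, ∃ N, ∀ i, N ≤ i → m ≤ D i := by
    intro m
    induction m with
    | zero => exact ⟨0, fun i _ => Nat.zero_le _⟩
    | succ m ih =>
      obtain ⟨N, hN⟩ := ih
      obtain ⟨j, hj, hl⟩ := ha3 N
      refine ⟨j + 1, fun i hi => ?_⟩
      have := hmono hi
      have := hD1 j hl
      have := hN j hj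
      omega
  have := mainLem α ρ D hat hD0 hD1 hD2 hg hinf ψ (fun i => (ht i).1.2) (fun i => (ht i).2.2.2)
    hi.2.1 ⟨ha1, ha2⟩ 0
  rw [hD0] at this
  exact this.1 hi.2.2

def canon {AP : Type} (α : ℕ → Set AP) (i : ℕ) : BASt AP where
  val φ _ := PLTL.sat (S := Set AP) id α φ i
  inLoop := True
  le := True

theorem untlStep (F G : ℕ → Prop) (i : ℕ) :
    (∃ j, i ≤ j ∧ G j ∧ ∀ n, i ≤ n → n < j → F n) ↔
      (G i ∨ (F i ∧ ∃ j, i + 1 ≤ j ∧ G j ∧ ∀ n, i + 1 ≤ n → n < j → F n)) := by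
  constructor
  · rintro ⟨j, a, b, c⟩
    by_cases h : j = i
    · left; rw [← h]; exact b
    · exact Or.inr ⟨c i le_rfl (by omega), j, by omega, b, fun n d e => c n (by omega) e⟩
  · rintro (h | ⟨h, j, a, b, c⟩)
    · exact ⟨i, le_rfl, h, fun n a b => by omega⟩
    · refine ⟨j, by omega, b, fun n d e => ?_⟩
      by_cases hn : n = i
      · rw [hn]; exact h
      · exact c n (by omega) e

theorem relsStep (F G : ℕ → Prop) (i : ℕ) :
    (∀ j, i ≤ j → (G j ∨ ∃ n, i ≤ n ∧ n < j ∧ F n)) ↔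
      (G i ∧ (F i ∨ ∀ j, i + 1 ≤ j → (G j ∨ ∃ n, i + 1 ≤ n ∧ n < j ∧ F n))) := by
  have := untlStep (fun i => ¬ F i) (fun i => ¬ G i) i
  rw [← not_iff_not]
  push Not
  exact this.trans imp_iff_not_or.symm

theorem sinceStep (F G : ℕ → Prop) (i : ℕ) :
    (∃ j, j ≤ i + 1 ∧ G j ∧ ∀ n, j < n → n ≤ i + 1 → F n) ↔
      (G (i + 1) ∨ (F (i + 1) ∧ ∃ j, j ≤ i ∧ G j ∧ ∀ n, j < n → n ≤ i → F n)) := by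
  constructor
  · rintro ⟨j, a, b, c⟩
    by_cases h : j = i + 1
    · left; rw [← h]; exact b
    · exact Or.inr ⟨c _ (by omega) le_rfl, j, by omega, b, fun n d e => c n d (by omega)⟩
  · rintro (h | ⟨h, j, a, b, c⟩)
    · exact ⟨i + 1, le_rfl, h, fun n a b => by omega⟩
    · refine ⟨j, by omega, b, fun n d e => ?_⟩
      by_cases hn : n = i + 1
      · rw [hn]; exact h
      · exact c n d (by omega)

theorem trigStep (F G : ℕ → Prop) (i : ℕ) :
    (∀ j, j ≤ i + 1 → (G j ∨ ∃ n, j < n ∧ n ≤ i + 1 ∧ F n)) ↔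
      (G (i + 1) ∧ (F (i + 1) ∨ ∀ j, j ≤ i → (G j ∨ ∃ n, j < n ∧ n ≤ i ∧ F n))) := by
  have := sinceStep (fun i => ¬ F i) (fun i => ¬ G i) i
  rw [← not_iff_not]
  push Not
  exact this.trans imp_iff_not_or.symm

theorem canonSt {AP : Type} (α : ℕ → Set AP) (i : ℕ) (φ : PLTL AP) : baStC (canon α i) φ := by
  induction φ with
  | atom p => trivial
  | natom p => exact Iff.rfl
  | conj f g ihf ihg => exact ⟨ihf, ihg, fun _ _ => Iff.rfl⟩
  | disj f g ihf ihg => exact ⟨ihf, ihg, fun _ _ => Iff.rfl⟩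
  | next f ihf => exact ihf
  | prev f ihf => exact ihf
  | wprev f ihf => exact ihf
  | untl f g ihf ihg => exact ⟨ihf, ihg⟩
  | rels f g ihf ihg => exact ⟨ihf, ihg⟩
  | since f g ihf ihg => exact ⟨ihf, ihg⟩
  | trig f g ihf ihg => exact ⟨ihf, ihg⟩

theorem canonInit {AP : Type} (α : ℕ → Set AP) (φ : PLTL AP) : baInitC (canon α 0) φ := by
  induction φ with
  | atom p => trivial
  | natom p => trivial
  | conj f g ihf ihg => exact ⟨ihf, ihg⟩
  | disj f g ihf ihg => exact ⟨ihf, ihg⟩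
  | next f ihf => exact ihf
  | prev f ihf => exact ⟨ihf, fun h => absurd h.1 (lt_irrefl _)⟩
  | wprev f ihf => exact ⟨ihf, Or.inl rfl⟩
  | untl f g ihf ihg => exact ⟨ihf, ihg⟩
  | rels f g ihf ihg => exact ⟨ihf, ihg⟩
  | since f g ihf ihg =>
    refine ⟨ihf, ihg, ?_⟩
    constructor
    · rintro ⟨j, a, b, c⟩
      obtain rfl : j = 0 := by omega
      exact b
    · intro h; exact ⟨0, le_rfl, h, fun n a b => by omega⟩
  | trig f g ihf ihg =>
    refine ⟨ihf, ihg, ?_⟩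
    constructor
    · intro h
      rcases h 0 le_rfl with h | ⟨n, a, b, c⟩
      · exact h
      · omega
    · intro h j hj
      obtain rfl : j = 0 := by omega
      exact Or.inl h

theorem canonTr {AP : Type} (α : ℕ → Set AP) (i : ℕ) (φ : PLTL AP) :
    baTrC (canon α i) (canon α (i + 1)) φ := by
  induction φ with
  | atom p => trivial
  | natom p => trivial
  | conj f g ihf ihg => exact ⟨ihf, ihg⟩
  | disj f g ihf ihg => exact ⟨ihf, ihg⟩
  | next f ihf => exact ⟨ihf, fun d _ => ⟨fun h => absurd trivial h.1, fun _ => Iff.rfl⟩⟩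
  | prev f ihf =>
    refine ⟨ihf, fun d _ => ⟨fun h => absurd trivial h.1, fun _ => ?_⟩⟩
    exact ⟨fun h => h.2, fun h => ⟨Nat.succ_pos _, h⟩⟩
  | wprev f ihf =>
    refine ⟨ihf, fun d _ => ⟨fun h => absurd trivial h.1, fun _ => ?_⟩⟩
    exact ⟨fun h => h.resolve_left (Nat.succ_ne_zero _), fun h => Or.inr h⟩
  | untl f g ihf ihg =>
    exact ⟨ihf, ihg, fun d _ => ⟨fun h => absurd trivial h.1, fun _ => untlStep _ _ i⟩⟩
  | rels f g ihf ihg =>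
    exact ⟨ihf, ihg, fun d _ => ⟨fun h => absurd trivial h.1, fun _ => relsStep _ _ i⟩⟩
  | since f g ihf ihg =>
    exact ⟨ihf, ihg, fun d _ => ⟨fun h => absurd trivial h.1, fun _ => sinceStep _ _ i⟩⟩
  | trig f g ihf ihg =>
    exact ⟨ihf, ihg, fun d _ => ⟨fun h => absurd trivial h.1, fun _ => trigStep _ _ i⟩⟩

theorem complete {AP : Type} (ψ : PLTL AP) (α : ℕ → Set AP) (h : wordSat α ψ) : baLang ψ α := by
  refine ⟨canon α, ⟨⟨⟨fun _ => trivial, canonSt α 0 ψ⟩, canonInit α ψ, h⟩, fun i =>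
    ⟨⟨fun _ => trivial, canonSt α i ψ⟩, ⟨fun _ => trivial, canonSt α (i + 1) ψ⟩, fun _ => trivial,
      canonTr α i ψ⟩, fun i p => Iff.rfl⟩, ?_, ?_, fun N => ⟨N, le_rfl, trivial⟩⟩
  · intro f g _ N
    by_cases hU : PLTL.sat (S := Set AP) id α (.untl f g) N
    · obtain ⟨j, a, b, c⟩ := hU
      exact ⟨j, a, Or.inr b⟩
    · exact ⟨N, le_rfl, Or.inl hU⟩
  · intro f g _ N
    by_cases hU : PLTL.sat (S := Set AP) id α (.rels f g) N
    · exact ⟨N, le_rfl, Or.inl hU⟩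
    · simp only [PLTL.sat] at hU
      push Not at hU
      obtain ⟨j, a, b, c⟩ := hU
      exact ⟨j, a, Or.inr b⟩

end BMC
open BMC in
/-- Lemma (correctness of the tight Büchi automaton obtained by virtual
unrolling): `L(B^ψ) = {α | α ⊨ ψ}`. -/
theorem tight_buchi_lang_correct {AP : Type} (ψ : PLTL AP) :
    ∀ α : ℕ → Set AP, baLang ψ α ↔ wordSat α ψ := by
  intro α
  exact ⟨sound ψ α, complete ψ α⟩
end

section
/- Let ψ be a PLTL formula and let B^ψ be the tight symbolic Büchi automaton obtained by virtual unrolling up to past operator depth δ(ψ). Then B^ψ is tight: for every ultimately periodic word α = βγ^ω ∈ L(B^ψ) there is an accepting run ρ = στ^ω of B^ψ on α with |σ| = |β| and |τ| = |γ|. -/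
namespace BMC

variable {AP : Type}

def Un (F G : ℕ → Prop) (i : ℕ) : Prop := ∃ j, i ≤ j ∧ G j ∧ ∀ n, i ≤ n → n < j → F n

def Sn (F G : ℕ → Prop) (i : ℕ) : Prop := ∃ j, j ≤ i ∧ G j ∧ ∀ n, j < n → n ≤ i → F n

lemma rel_iff (F G : ℕ → Prop) (i : ℕ) :
    (∀ j, i ≤ j → (G j ∨ ∃ n, i ≤ n ∧ n < j ∧ F n)) ↔
      ¬ Un (fun n => ¬ F n) (fun n => ¬ G n) i := by
  unfold Un
  push Not
  refine forall_congr' fun j => ?_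
  by_cases h : G j <;> simp [h]

lemma trig_iff (F G : ℕ → Prop) (i : ℕ) :
    (∀ j, j ≤ i → (G j ∨ ∃ n, j < n ∧ n ≤ i ∧ F n)) ↔
      ¬ Sn (fun n => ¬ F n) (fun n => ¬ G n) i := by
  unfold Sn
  push Not
  refine forall_congr' fun j => ?_
  by_cases h : G j <;> simp [h]

lemma Un_step (F G : ℕ → Prop) (i : ℕ) : Un F G i ↔ (G i ∨ (F i ∧ Un F G (i + 1))) := by
  constructor
  · rintro ⟨j, hj, hg, hf⟩
    rcases Nat.eq_or_lt_of_le hj with rfl | hlt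
    · exact Or.inl hg
    · exact Or.inr ⟨hf i le_rfl hlt, j, hlt, hg, fun n h1 h2 => hf n (by omega) h2⟩
  · rintro (hg | ⟨h, j, hj, hg, hf⟩)
    · exact ⟨i, le_rfl, hg, fun n h1 h2 => by omega⟩
    · refine ⟨j, by omega, hg, fun n h1 h2 => ?_⟩
      rcases Nat.eq_or_lt_of_le h1 with rfl | hlt
      · exact h
      · exact hf n hlt h2

lemma Sn_zero (F G : ℕ → Prop) : Sn F G 0 ↔ G 0 := by
  constructor
  · rintro ⟨j, hj, hg, -⟩
    obtain rfl : j = 0 := by omega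
    exact hg
  · intro h
    exact ⟨0, le_rfl, h, fun n h1 h2 => by omega⟩

lemma Sn_step (F G : ℕ → Prop) (i : ℕ) :
    Sn F G (i + 1) ↔ (G (i + 1) ∨ (F (i + 1) ∧ Sn F G i)) := by
  constructor
  · rintro ⟨j, hj, hg, hf⟩
    rcases Nat.eq_or_lt_of_le hj with rfl | hlt
    · exact Or.inl hg
    · exact Or.inr ⟨hf (i+1) hlt le_rfl, j, by omega, hg, fun n h1 h2 => hf n h1 (by omega)⟩
  · rintro (hg | ⟨h, j, hj, hg, hf⟩)
    · exact ⟨i + 1, le_rfl, hg, fun n h1 h2 => by omega⟩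
    · refine ⟨j, by omega, hg, fun n h1 h2 => ?_⟩
      rcases Nat.eq_or_lt_of_le h2 with rfl | hlt
      · exact h
      · exact hf n h1 (by omega)

lemma Un_unique (F G v : ℕ → Prop) (h : ∀ i, v i ↔ (G i ∨ (F i ∧ v (i + 1))))
    (hacc : ∀ N, ∃ i, N ≤ i ∧ (¬ v i ∨ G i)) (i : ℕ) : v i ↔ Un F G i := by
  constructor
  · intro hv
    by_contra hn
    have key : ∀ k, v (i + k) ∧ ¬ Un F G (i + k) := by
      intro k
      induction k with
      | zero => exact ⟨hv, hn⟩
      | succ k ih =>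
        obtain ⟨h1, h2⟩ := ih
        rw [h] at h1
        rw [Un_step] at h2
        have : i + (k + 1) = i + k + 1 := by omega
        rw [this]
        tauto
    obtain ⟨m, hm, hm2⟩ := hacc i
    have := key (m - i)
    rw [show i + (m - i) = m by omega, Un_step] at this
    tauto
  · rintro ⟨j, hj, hg, hf⟩
    obtain ⟨k, rfl⟩ := Nat.exists_eq_add_of_le hj
    clear hj
    induction k generalizing i with
    | zero => rw [h]; exact Or.inl hg
    | succ k ih =>
      rw [h]
      refine Or.inr ⟨hf i le_rfl (by omega), ih (i + 1) ?_ ?_⟩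
      · rwa [show i + 1 + k = i + (k + 1) by omega]
      · intro n h1 h2
        exact hf n (by omega) (by omega)

lemma Sn_unique (F G v : ℕ → Prop) (h0 : v 0 ↔ G 0)
    (h : ∀ i, v (i + 1) ↔ (G (i + 1) ∨ (F (i + 1) ∧ v i))) (i : ℕ) : v i ↔ Sn F G i := by
  induction i with
  | zero => rw [h0, Sn_zero]
  | succ i ih => rw [h, Sn_step, ih]

lemma Un_per (F G : ℕ → Prop) (c p : ℕ) (hF : ∀ i, c ≤ i → (F (i + p) ↔ F i))
    (hG : ∀ i, c ≤ i → (G (i + p) ↔ G i)) (i : ℕ) (hi : c ≤ i) :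
    Un F G (i + p) ↔ Un F G i := by
  constructor
  · rintro ⟨j, hj, hg, hf⟩
    obtain ⟨k, rfl⟩ := Nat.exists_eq_add_of_le' (show p ≤ j by omega)
    exact ⟨k, by omega, (hG k (by omega)).1 hg,
      fun n h1 h2 => (hF n (by omega)).1 (hf _ (by omega) (by omega))⟩
  · rintro ⟨j, hj, hg, hf⟩
    refine ⟨j + p, by omega, (hG j (by omega)).2 hg, fun n h1 h2 => ?_⟩
    obtain ⟨k, rfl⟩ := Nat.exists_eq_add_of_le' (show p ≤ n by omega)
    exact (hF k (by omega)).2 (hf _ (by omega) (by omega))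

lemma Sn_per (F G : ℕ → Prop) (c p : ℕ) (hF : ∀ i, c ≤ i → (F (i + p) ↔ F i))
    (hG : ∀ i, c ≤ i → (G (i + p) ↔ G i)) (i : ℕ) (hi : c + p ≤ i) :
    Sn F G (i + p) ↔ Sn F G i := by
  constructor
  · rintro ⟨j, hj, hg, hf⟩
    by_cases hc : c + p ≤ j
    · obtain ⟨k, rfl⟩ := Nat.exists_eq_add_of_le' (show p ≤ j by omega)
      exact ⟨k, by omega, (hG k (by omega)).1 hg,
        fun n h1 h2 => (hF n (by omega)).1 (hf _ (by omega) (by omega))⟩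
    · exact ⟨j, by omega, hg, fun n h1 h2 => hf n h1 (by omega)⟩
  · rintro ⟨j, hj, hg, hf⟩
    by_cases hc : c ≤ j
    · refine ⟨j + p, by omega, (hG j (by omega)).2 hg, fun n h1 h2 => ?_⟩
      obtain ⟨k, rfl⟩ := Nat.exists_eq_add_of_le' (show p ≤ n by omega)
      exact (hF k (by omega)).2 (hf _ (by omega) (by omega))
    · refine ⟨j, by omega, hg, fun n h1 h2 => ?_⟩
      by_cases hn : n ≤ i
      · exact hf n h1 hn
      · obtain ⟨k, rfl⟩ := Nat.exists_eq_add_of_le' (show p ≤ n by omega)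
        exact (hF k (by omega)).2 (hf _ (by omega) (by omega))

/-- Satisfaction on words. -/
abbrev ws (α : ℕ → Set AP) (φ : PLTL AP) (i : ℕ) : Prop := PLTL.sat (S := Set AP) id α φ i

section
variable (α : ℕ → Set AP) (f g : PLTL AP) (i : ℕ)

lemma ws_untl : ws α (.untl f g) i ↔ Un (ws α f) (ws α g) i := Iff.rfl
lemma ws_since : ws α (.since f g) i ↔ Sn (ws α f) (ws α g) i := Iff.rfl
lemma ws_rels : ws α (.rels f g) i ↔ ¬ Un (fun n => ¬ ws α f n) (fun n => ¬ ws α g n) i :=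
  rel_iff (ws α f) (ws α g) i
lemma ws_trig : ws α (.trig f g) i ↔ ¬ Sn (fun n => ¬ ws α f n) (fun n => ¬ ws α g n) i :=
  trig_iff (ws α f) (ws α g) i

end

lemma ws_per (α : ℕ → Set AP) (b p : ℕ) (hp : 0 < p)
    (hper : ∀ i, b ≤ i → α (i + p) = α i) (φ : PLTL AP) :
    ∀ m, φ.delta ≤ m → ∀ i, b + m * p ≤ i → (ws α φ (i + p) ↔ ws α φ i) := by
  induction φ with
  | atom q =>
    intro m _ i hi
    have : b ≤ i := le_trans (Nat.le_add_right _ _) hi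
    simp [ws, PLTL.sat, hper i this]
  | natom q =>
    intro m _ i hi
    have : b ≤ i := le_trans (Nat.le_add_right _ _) hi
    simp [ws, PLTL.sat, hper i this]
  | conj f g ihf ihg =>
    intro m hm i hi
    simp only [PLTL.delta, max_le_iff] at hm
    exact and_congr (ihf m hm.1 i hi) (ihg m hm.2 i hi)
  | disj f g ihf ihg =>
    intro m hm i hi
    simp only [PLTL.delta, max_le_iff] at hm
    exact or_congr (ihf m hm.1 i hi) (ihg m hm.2 i hi)
  | next f ihf =>
    intro m hm i hi
    have := ihf m hm (i + 1) (by omega)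
    rw [show i + 1 + p = i + p + 1 by omega] at this
    exact this
  | untl f g ihf ihg =>
    intro m hm i hi
    simp only [PLTL.delta, max_le_iff] at hm
    rw [ws_untl, ws_untl]
    exact Un_per _ _ _ p (ihf m hm.1) (ihg m hm.2) i hi
  | rels f g ihf ihg =>
    intro m hm i hi
    simp only [PLTL.delta, max_le_iff] at hm
    rw [ws_rels, ws_rels]
    exact not_congr (Un_per _ _ _ p (fun i hi => not_congr (ihf m hm.1 i hi))
      (fun i hi => not_congr (ihg m hm.2 i hi)) i hi)
  | prev f ihf =>
    intro m hm i hi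
    simp only [PLTL.delta] at hm
    obtain ⟨k, rfl⟩ := Nat.exists_eq_add_of_le' (show 1 ≤ m by omega)
    rw [Nat.add_mul] at hi
    have := ihf k (by omega) (i - 1) (by omega)
    rw [show i - 1 + p = i + p - 1 by omega] at this
    exact and_congr (by omega) this
  | wprev f ihf =>
    intro m hm i hi
    simp only [PLTL.delta] at hm
    obtain ⟨k, rfl⟩ := Nat.exists_eq_add_of_le' (show 1 ≤ m by omega)
    rw [Nat.add_mul] at hi
    have := ihf k (by omega) (i - 1) (by omega)
    rw [show i - 1 + p = i + p - 1 by omega] at this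
    exact or_congr (by omega) this
  | since f g ihf ihg =>
    intro m hm i hi
    simp only [PLTL.delta] at hm
    obtain ⟨k, rfl⟩ := Nat.exists_eq_add_of_le' (show 1 ≤ m by omega)
    rw [Nat.add_mul] at hi
    rw [ws_since, ws_since]
    exact Sn_per _ _ (b + k * p) p (ihf k (by omega)) (ihg k (by omega)) i (by omega)
  | trig f g ihf ihg =>
    intro m hm i hi
    simp only [PLTL.delta] at hm
    obtain ⟨k, rfl⟩ := Nat.exists_eq_add_of_le' (show 1 ≤ m by omega)
    rw [Nat.add_mul] at hi
    rw [ws_trig, ws_trig]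
    exact not_congr (Sn_per _ _ (b + k * p) p (fun i hi => not_congr (ihf k (by omega) i hi))
      (fun i hi => not_congr (ihg k (by omega) i hi)) i (by omega))

lemma bv_min (x : BASt AP) (φ : PLTL AP) (d m : ℕ) (h : φ.delta ≤ m) :
    bv x φ (min d m) = bv x φ d := by
  unfold bv; congr 1; omega

lemma bv_min_succ (x : BASt AP) (φ : PLTL AP) (d m : ℕ) (h : φ.delta ≤ m) :
    bv x φ (min d m + 1) = bv x φ (d + 1) := by
  unfold bv; congr 1; omega

lemma val_min (x : BASt AP) (φ : PLTL AP) (d : ℕ) :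
    x.val φ (min d φ.delta) = bv x φ d := rfl

/-- Instantiating a transition constraint at the current unrolling. -/
lemma use_tr (x y : BASt AP) (D D' m : ℕ) (P Q : ℕ → Prop)
    (h : ∀ d, d ≤ m → ((¬ x.le ∧ ¬ (¬ x.inLoop ∧ y.inLoop ∧ 0 < d)) → P d) ∧ (x.le → Q d))
    (h0 : ¬ x.inLoop → D = 0) (h1 : x.le → D' = D + 1) (h2 : ¬ x.le → D' = D) :
    (D' = D ∧ P (min D m)) ∨ (D' = D + 1 ∧ Q (min D m)) := by
  obtain ⟨hP, hQ⟩ := h (min D m) (by omega)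
  by_cases hl : x.le
  · exact Or.inr ⟨h1 hl, hQ hl⟩
  · refine Or.inl ⟨h2 hl, hP ⟨hl, ?_⟩⟩
    rintro ⟨h3, -, h4⟩
    have := h0 h3
    omega

lemma sound_s11 (α : ℕ → Set AP) (ρ : ℕ → BASt AP) (D : ℕ → ℕ) (hD0 : D 0 = 0)
    (hDl : ∀ i, ¬ (ρ i).inLoop → D i = 0)
    (hD1 : ∀ i, (ρ i).le → D (i + 1) = D i + 1) (hD2 : ∀ i, ¬ (ρ i).le → D (i + 1) = D i)
    (hDinf : ∀ M, ∃ N, ∀ i, N ≤ i → M ≤ D i)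
    (hlab : ∀ i, ∀ p : AP, ((ρ i).val (.atom p) 0 ↔ p ∈ α i)) (φ : PLTL AP) :
    (∀ i, baStC (ρ i) φ) → (∀ i, baTrC (ρ i) (ρ (i + 1)) φ) → baInitC (ρ 0) φ →
    (∀ f g : PLTL AP, (PLTL.untl f g).Subf φ →
    ∀ N, ∃ i, N ≤ i ∧
      (¬ bv (ρ i) (.untl f g) (PLTL.untl f g).delta ∨
        bv (ρ i) g (PLTL.untl f g).delta)) →
    (∀ f g : PLTL AP, (PLTL.rels f g).Subf φ →
    ∀ N, ∃ i, N ≤ i ∧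
      (bv (ρ i) (.rels f g) (PLTL.rels f g).delta ∨
        ¬ bv (ρ i) g (PLTL.rels f g).delta)) →
    ∀ i, bv (ρ i) φ (D i) ↔ ws α φ i := by
  have acc : ∀ (P : ℕ → Prop) (m : ℕ), (∀ N, ∃ i, N ≤ i ∧ P i) →
      ∀ N, ∃ i, N ≤ i ∧ m ≤ D i ∧ P i := by
    intro P m h N
    obtain ⟨N', hN'⟩ := hDinf m
    obtain ⟨i, hi, hPi⟩ := h (max N N')
    exact ⟨i, by omega, hN' i (by omega), hPi⟩
  have bvm : ∀ (x : BASt AP) (φ : PLTL AP) (d m : ℕ), φ.delta ≤ m → m ≤ d →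
      bv x φ m = bv x φ d := by
    intro x φ d m h1 h2
    unfold bv; congr 1; omega
  induction φ with
  | atom q =>
    intro _ _ _ _ _ i
    simp only [bv, PLTL.delta, Nat.min_zero]
    exact hlab i q
  | natom q =>
    intro hS _ _ _ _ i
    have := hS i
    simp only [baStC, bv, PLTL.delta, Nat.min_zero] at this
    simp only [bv, PLTL.delta, Nat.min_zero, this, hlab]
    exact Iff.rfl
  | conj f g ihf ihg =>
    intro hS hT hI hU hR i
    have ihf := ihf (fun i => (hS i).1) (fun i => (hT i).1) hI.1
      (fun a b h => hU a b (List.mem_cons_of_mem _ (List.mem_append_left _ h)))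
      (fun a b h => hR a b (List.mem_cons_of_mem _ (List.mem_append_left _ h)))
    have ihg := ihg (fun i => (hS i).2.1) (fun i => (hT i).2) hI.2
      (fun a b h => hU a b (List.mem_cons_of_mem _ (List.mem_append_right _ h)))
      (fun a b h => hR a b (List.mem_cons_of_mem _ (List.mem_append_right _ h)))
    have := (hS i).2.2 (min (D i) (PLTL.conj f g).delta) (by omega)
    rw [val_min, bv_min _ _ _ _ (by simp [PLTL.delta]), bv_min _ _ _ _ (by simp [PLTL.delta]),
      ihf, ihg] at this
    exact this
  | disj f g ihf ihg =>
    intro hS hT hI hU hR i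
    have ihf := ihf (fun i => (hS i).1) (fun i => (hT i).1) hI.1
      (fun a b h => hU a b (List.mem_cons_of_mem _ (List.mem_append_left _ h)))
      (fun a b h => hR a b (List.mem_cons_of_mem _ (List.mem_append_left _ h)))
    have ihg := ihg (fun i => (hS i).2.1) (fun i => (hT i).2) hI.2
      (fun a b h => hU a b (List.mem_cons_of_mem _ (List.mem_append_right _ h)))
      (fun a b h => hR a b (List.mem_cons_of_mem _ (List.mem_append_right _ h)))
    have := (hS i).2.2 (min (D i) (PLTL.disj f g).delta) (by omega)
    rw [val_min, bv_min _ _ _ _ (by simp [PLTL.delta]), bv_min _ _ _ _ (by simp [PLTL.delta]),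
      ihf, ihg] at this
    exact this
  | next f ihf =>
    intro hS hT hI hU hR i
    have ihf := ihf (fun i => (hS i)) (fun i => (hT i).1) hI
      (fun a b h => hU a b (List.mem_cons_of_mem _ h))
      (fun a b h => hR a b (List.mem_cons_of_mem _ h))
    have hs : f.delta ≤ (PLTL.next f).delta := by simp [PLTL.delta]
    have e : ws α (.next f) i ↔ ws α f (i + 1) := Iff.rfl
    rw [e, ← ihf]
    rcases use_tr _ _ (D i) (D (i+1)) _ _ _ (hT i).2 (hDl i) (hD1 i) (hD2 i) with ⟨h1, h2⟩ | ⟨h1, h2⟩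
    · rw [val_min, bv_min _ _ _ _ hs, ← h1] at h2
      rw [← h2, h1]
    · rw [val_min, bv_min_succ _ _ _ _ hs, ← h1] at h2
      exact h2
  | untl f g ihf ihg =>
    intro hS hT hI hU hR i
    have ihf := ihf (fun i => (hS i).1) (fun i => (hT i).1) hI.1
      (fun a b h => hU a b (List.mem_cons_of_mem _ (List.mem_append_left _ h)))
      (fun a b h => hR a b (List.mem_cons_of_mem _ (List.mem_append_left _ h)))
    have ihg := ihg (fun i => (hS i).2) (fun i => (hT i).2.1) hI.2
      (fun a b h => hU a b (List.mem_cons_of_mem _ (List.mem_append_right _ h)))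
      (fun a b h => hR a b (List.mem_cons_of_mem _ (List.mem_append_right _ h)))
    have hs1 : f.delta ≤ (PLTL.untl f g).delta := by simp [PLTL.delta]
    have hs2 : g.delta ≤ (PLTL.untl f g).delta := by simp [PLTL.delta]
    rw [ws_untl]
    refine Un_unique (ws α f) (ws α g) (fun i => bv (ρ i) (.untl f g) (D i)) ?_ ?_ i
    · intro i
      simp only [← ihf, ← ihg]
      rcases use_tr _ _ (D i) (D (i+1)) _ _ _ (hT i).2.2 (hDl i) (hD1 i) (hD2 i) with
        ⟨h1, h2⟩ | ⟨h1, h2⟩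
      · rw [val_min, bv_min _ _ _ _ hs1, bv_min _ _ _ _ hs2, bv_min _ _ _ _ le_rfl] at h2
        rw [h1]; exact h2
      · rw [val_min, bv_min _ _ _ _ hs1, bv_min _ _ _ _ hs2, bv_min_succ _ _ _ _ le_rfl] at h2
        rw [h1]; exact h2
    · intro N
      obtain ⟨i, hi, hd, hi2⟩ := acc _ (PLTL.untl f g).delta (hU f g (List.mem_cons_self ..)) N
      rw [bvm _ _ _ _ le_rfl hd, bvm _ _ _ _ hs2 hd, ihg] at hi2
      exact ⟨i, hi, hi2⟩
  | rels f g ihf ihg =>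
    intro hS hT hI hU hR i
    have ihf := ihf (fun i => (hS i).1) (fun i => (hT i).1) hI.1
      (fun a b h => hU a b (List.mem_cons_of_mem _ (List.mem_append_left _ h)))
      (fun a b h => hR a b (List.mem_cons_of_mem _ (List.mem_append_left _ h)))
    have ihg := ihg (fun i => (hS i).2) (fun i => (hT i).2.1) hI.2
      (fun a b h => hU a b (List.mem_cons_of_mem _ (List.mem_append_right _ h)))
      (fun a b h => hR a b (List.mem_cons_of_mem _ (List.mem_append_right _ h)))
    have hs1 : f.delta ≤ (PLTL.rels f g).delta := by simp [PLTL.delta]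
    have hs2 : g.delta ≤ (PLTL.rels f g).delta := by simp [PLTL.delta]
    rw [ws_rels, iff_not_comm, iff_comm]
    refine Un_unique (fun n => ¬ ws α f n) (fun n => ¬ ws α g n)
      (fun i => ¬ bv (ρ i) (.rels f g) (D i)) ?_ ?_ i
    · intro i
      simp only [← ihf, ← ihg]
      rcases use_tr _ _ (D i) (D (i+1)) _ _ _ (hT i).2.2 (hDl i) (hD1 i) (hD2 i) with
        ⟨h1, h2⟩ | ⟨h1, h2⟩
      · rw [val_min, bv_min _ _ _ _ hs1, bv_min _ _ _ _ hs2, bv_min _ _ _ _ le_rfl] at h2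
        rw [h1, h2, not_and_or, not_or]
      · rw [val_min, bv_min _ _ _ _ hs1, bv_min _ _ _ _ hs2, bv_min_succ _ _ _ _ le_rfl] at h2
        rw [h1, h2, not_and_or, not_or]
    · intro N
      obtain ⟨i, hi, hd, hi2⟩ := acc _ (PLTL.rels f g).delta (hR f g (List.mem_cons_self ..)) N
      rw [bvm _ _ _ _ le_rfl hd, bvm _ _ _ _ hs2 hd, ihg] at hi2
      exact ⟨i, hi, hi2.imp_left not_not_intro⟩
  | prev f ihf =>
    intro hS hT hI hU hR i
    have ihf := ihf (fun i => (hS i)) (fun i => (hT i).1) hI.1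
      (fun a b h => hU a b (List.mem_cons_of_mem _ h))
      (fun a b h => hR a b (List.mem_cons_of_mem _ h))
    have hs : f.delta ≤ (PLTL.prev f).delta := by simp [PLTL.delta]
    cases i with
    | zero =>
      have := hI.2
      simp only [hD0, bv, Nat.zero_min, this, ws, PLTL.sat]
      simp
    | succ i =>
      have e : ws α (.prev f) (i + 1) ↔ ws α f i := by simp [ws, PLTL.sat]
      rw [e, ← ihf]
      rcases use_tr _ _ (D i) (D (i+1)) _ _ _ (hT i).2 (hDl i) (hD1 i) (hD2 i) with
        ⟨h1, h2⟩ | ⟨h1, h2⟩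
      · rw [val_min, bv_min _ _ _ _ hs] at h2
        rw [← h2, h1]
      · rw [bv_min _ _ _ _ hs, bv_min_succ _ _ _ _ le_rfl, ← h1] at h2
        exact h2
  | wprev f ihf =>
    intro hS hT hI hU hR i
    have ihf := ihf (fun i => (hS i)) (fun i => (hT i).1) hI.1
      (fun a b h => hU a b (List.mem_cons_of_mem _ h))
      (fun a b h => hR a b (List.mem_cons_of_mem _ h))
    have hs : f.delta ≤ (PLTL.wprev f).delta := by simp [PLTL.delta]
    cases i with
    | zero =>
      have := hI.2
      simp only [hD0, bv, Nat.zero_min, this, ws, PLTL.sat]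
      simp
    | succ i =>
      have e : ws α (.wprev f) (i + 1) ↔ ws α f i := by simp [ws, PLTL.sat]
      rw [e, ← ihf]
      rcases use_tr _ _ (D i) (D (i+1)) _ _ _ (hT i).2 (hDl i) (hD1 i) (hD2 i) with
        ⟨h1, h2⟩ | ⟨h1, h2⟩
      · rw [val_min, bv_min _ _ _ _ hs] at h2
        rw [← h2, h1]
      · rw [bv_min _ _ _ _ hs, bv_min_succ _ _ _ _ le_rfl, ← h1] at h2
        exact h2
  | since f g ihf ihg =>
    intro hS hT hI hU hR i
    have ihf := ihf (fun i => (hS i).1) (fun i => (hT i).1) hI.1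
      (fun a b h => hU a b (List.mem_cons_of_mem _ (List.mem_append_left _ h)))
      (fun a b h => hR a b (List.mem_cons_of_mem _ (List.mem_append_left _ h)))
    have ihg := ihg (fun i => (hS i).2) (fun i => (hT i).2.1) hI.2.1
      (fun a b h => hU a b (List.mem_cons_of_mem _ (List.mem_append_right _ h)))
      (fun a b h => hR a b (List.mem_cons_of_mem _ (List.mem_append_right _ h)))
    have hs1 : f.delta ≤ (PLTL.since f g).delta := by simp only [PLTL.delta]; omega
    have hs2 : g.delta ≤ (PLTL.since f g).delta := by simp only [PLTL.delta]; omega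
    rw [ws_since]
    refine Sn_unique (ws α f) (ws α g) (fun i => bv (ρ i) (.since f g) (D i)) ?_ ?_ i
    · simp only [← ihg, hD0]
      have := hI.2.2
      rw [← this]
      simp [bv]
    · intro i
      simp only [← ihf, ← ihg]
      rcases use_tr _ _ (D i) (D (i+1)) _ _ _ (hT i).2.2 (hDl i) (hD1 i) (hD2 i) with
        ⟨h1, h2⟩ | ⟨h1, h2⟩
      · rw [val_min, val_min, bv_min _ _ _ _ hs1, bv_min _ _ _ _ hs2] at h2
        rw [h1]; exact h2
      · rw [val_min, bv_min_succ _ _ _ _ hs1, bv_min_succ _ _ _ _ hs2,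
          bv_min_succ _ _ _ _ le_rfl] at h2
        rw [h1]; exact h2
  | trig f g ihf ihg =>
    intro hS hT hI hU hR i
    have ihf := ihf (fun i => (hS i).1) (fun i => (hT i).1) hI.1
      (fun a b h => hU a b (List.mem_cons_of_mem _ (List.mem_append_left _ h)))
      (fun a b h => hR a b (List.mem_cons_of_mem _ (List.mem_append_left _ h)))
    have ihg := ihg (fun i => (hS i).2) (fun i => (hT i).2.1) hI.2.1
      (fun a b h => hU a b (List.mem_cons_of_mem _ (List.mem_append_right _ h)))
      (fun a b h => hR a b (List.mem_cons_of_mem _ (List.mem_append_right _ h)))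
    have hs1 : f.delta ≤ (PLTL.trig f g).delta := by simp only [PLTL.delta]; omega
    have hs2 : g.delta ≤ (PLTL.trig f g).delta := by simp only [PLTL.delta]; omega
    rw [ws_trig, iff_not_comm, iff_comm]
    refine Sn_unique (fun n => ¬ ws α f n) (fun n => ¬ ws α g n)
      (fun i => ¬ bv (ρ i) (.trig f g) (D i)) ?_ ?_ i
    · simp only [← ihg, hD0]
      have := hI.2.2
      rw [← this]
      simp [bv]
    · intro i
      simp only [← ihf, ← ihg]
      rcases use_tr _ _ (D i) (D (i+1)) _ _ _ (hT i).2.2 (hDl i) (hD1 i) (hD2 i) with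
        ⟨h1, h2⟩ | ⟨h1, h2⟩
      · rw [val_min, val_min, bv_min _ _ _ _ hs1, bv_min _ _ _ _ hs2] at h2
        rw [h1, h2, not_and_or, not_or]
      · rw [val_min, bv_min_succ _ _ _ _ hs1, bv_min_succ _ _ _ _ hs2,
          bv_min_succ _ _ _ _ le_rfl] at h2
        rw [h1, h2, not_and_or, not_or]

lemma lang_sat (ψ : PLTL AP) (α : ℕ → Set AP) (h : baLang ψ α) : ws α ψ 0 := by
  classical
  obtain ⟨ρ, ⟨hinit, htr, hlab⟩, hU, hR, hle⟩ := h
  let D : ℕ → ℕ := fun i => Nat.rec 0 (fun j d => if (ρ j).le then d + 1 else d) i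
  have hD0 : D 0 = 0 := rfl
  have hDs : ∀ i, D (i + 1) = if (ρ i).le then D i + 1 else D i := fun i => rfl
  have hmono : Monotone D := by
    apply monotone_nat_of_le_succ
    intro n
    rw [hDs]; split_ifs <;> omega
  have hinf : ∀ M, ∃ N, ∀ i, N ≤ i → M ≤ D i := by
    intro M
    induction M with
    | zero => exact ⟨0, fun i _ => Nat.zero_le _⟩
    | succ M ih =>
      obtain ⟨N, hN⟩ := ih
      obtain ⟨j, hj, hjl⟩ := hle N
      refine ⟨j + 1, fun i hi => le_trans ?_ (hmono hi)⟩
      rw [hDs, if_pos hjl]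
      have := hN j hj
      omega
  have hDl : ∀ i, ¬ (ρ i).inLoop → D i = 0 := by
    intro i
    induction i with
    | zero => intro _; rfl
    | succ i ih =>
      intro hn
      have h1 : ¬ (ρ i).inLoop := fun h => hn ((htr i).2.2.1 h)
      have h2 : ¬ (ρ i).le := fun h => h1 ((htr i).1.1 h)
      rw [hDs, if_neg h2, ih h1]
  have := sound_s11 α ρ D hD0 hDl (fun i h => by rw [hDs, if_pos h])
    (fun i h => by rw [hDs, if_neg h]) hinf hlab ψ (fun i => (htr i).1.2)
    (fun i => (htr i).2.2.2) hinit.2.1 hU hR 0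
  rw [← this, hD0]
  exact hinit.2.2

/-- Position represented by state `i` at unrolling `d`. -/
def pt (b p i d : ℕ) : ℕ := if i < b then i else b + (i - b) % p + d * p

/-- The tight run. -/
def tightRun (α : ℕ → Set AP) (b p i : ℕ) : BASt AP where
  val φ d := ws α φ (pt b p i d)
  inLoop := b ≤ i
  le := b ≤ i ∧ (i - b) % p + 1 = p

lemma ws_per_mul (α : ℕ → Set AP) (b p : ℕ) (hp : 0 < p)
    (hper : ∀ i, b ≤ i → α (i + p) = α i) (φ : PLTL AP) (m : ℕ) (hm : φ.delta ≤ m) (i : ℕ)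
    (hi : b + m * p ≤ i) (k : ℕ) : ws α φ (i + k * p) ↔ ws α φ i := by
  induction k with
  | zero => simp
  | succ k ih =>
    rw [Nat.succ_mul, ← Nat.add_assoc, ws_per α b p hp hper φ m hm _ (by omega), ih]

section
variable (α : ℕ → Set AP) (b p : ℕ) (hp : 0 < p) (hper : ∀ i, b ≤ i → α (i + p) = α i)
include hp hper

lemma bv_tight (φ : PLTL AP) (i d : ℕ) :
    bv (tightRun α b p i) φ d ↔ ws α φ (pt b p i d) := by
  simp only [bv, tightRun, pt]
  split_ifs with h
  · rfl
  · rcases le_total d φ.delta with hd | hd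
    · rw [min_eq_left hd]
    · rw [min_eq_right hd]
      obtain ⟨k, rfl⟩ := Nat.exists_eq_add_of_le hd
      rw [Nat.add_mul, ← Nat.add_assoc]
      exact (ws_per_mul α b p hp hper φ _ le_rfl _ (by omega) k).symm

lemma stC_tight (φ : PLTL AP) (i : ℕ) : baStC (tightRun α b p i) φ := by
  have B := bv_tight α b p hp hper
  induction φ with
  | atom q => trivial
  | natom q =>
    simp only [baStC, B]
    exact Iff.rfl
  | conj f g ihf ihg =>
    refine ⟨ihf, ihg, fun d _ => ?_⟩
    simp only [B]; exact Iff.rfl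
  | disj f g ihf ihg =>
    refine ⟨ihf, ihg, fun d _ => ?_⟩
    simp only [B]; exact Iff.rfl
  | next f ihf => exact ihf
  | untl f g ihf ihg => exact ⟨ihf, ihg⟩
  | rels f g ihf ihg => exact ⟨ihf, ihg⟩
  | prev f ihf => exact ihf
  | wprev f ihf => exact ihf
  | since f g ihf ihg => exact ⟨ihf, ihg⟩
  | trig f g ihf ihg => exact ⟨ihf, ihg⟩

lemma initC_tight (φ : PLTL AP) : baInitC (tightRun α b p 0) φ := by
  have B := bv_tight α b p hp hper
  have h0 : pt b p 0 0 = 0 := by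
    unfold pt; split_ifs with h
    · rfl
    · obtain rfl : b = 0 := by omega
      simp
  induction φ with
  | atom q => trivial
  | natom q => trivial
  | conj f g ihf ihg => exact ⟨ihf, ihg⟩
  | disj f g ihf ihg => exact ⟨ihf, ihg⟩
  | next f ihf => exact ihf
  | untl f g ihf ihg => exact ⟨ihf, ihg⟩
  | rels f g ihf ihg => exact ⟨ihf, ihg⟩
  | prev f ihf =>
    refine ⟨ihf, ?_⟩
    simp [tightRun, h0, ws, PLTL.sat]
  | wprev f ihf =>
    refine ⟨ihf, ?_⟩
    simp [tightRun, h0, ws, PLTL.sat]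
  | since f g ihf ihg =>
    refine ⟨ihf, ihg, ?_⟩
    simp only [B, h0]
    simp only [tightRun, h0]
    rw [ws_since, Sn_zero]
  | trig f g ihf ihg =>
    refine ⟨ihf, ihg, ?_⟩
    simp only [B, h0]
    simp only [tightRun, h0]
    rw [ws_trig, Sn_zero, not_not]

omit hper in
lemma pt_nle (i d : ℕ) (h : ¬ (tightRun α b p i).le ∧
    ¬ (¬ (tightRun α b p i).inLoop ∧ (tightRun α b p (i + 1)).inLoop ∧ 0 < d)) :
    pt b p (i + 1) d = pt b p i d + 1 := by
  simp only [tightRun] at h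
  obtain ⟨h1, h2⟩ := h
  unfold pt
  by_cases hi : i + 1 < b
  · rw [if_pos hi, if_pos (by omega)]
  · rw [if_neg hi]
    by_cases hi2 : i < b
    · rw [if_pos hi2]
      obtain rfl : d = 0 := by
        by_contra hd
        exact h2 ⟨by omega, by omega, by omega⟩
      obtain rfl : b = i + 1 := by omega
      simp
    · rw [if_neg hi2]
      have hlt := Nat.mod_lt (i - b) hp
      have : (i + 1 - b) % p = (i - b) % p + 1 := by
        rw [show i + 1 - b = (i - b) + 1 by omega, Nat.add_mod_of_add_mod_lt]
        · have : 1 < p := by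
            rcases Nat.lt_or_ge 1 p with h | h
            · exact h
            · exfalso; exact h1 ⟨by omega, by omega⟩
          rw [Nat.mod_eq_of_lt this]
        · have : 1 % p ≤ 1 := Nat.mod_le _ _
          have : ¬ ((i - b) % p + 1 = p) := fun h => h1 ⟨by omega, h⟩
          omega
      rw [this]; omega

omit hp hper in
lemma pt_le (i d : ℕ) (h : (tightRun α b p i).le) :
    pt b p (i + 1) (d + 1) = pt b p i d + 1 := by
  simp only [tightRun] at h
  obtain ⟨h1, h2⟩ := h
  unfold pt
  rw [if_neg (by omega), if_neg (by omega)]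
  have : (i + 1 - b) % p = 0 := by
    rw [show i + 1 - b = (i - b) + 1 by omega, ← Nat.mod_add_mod, h2, Nat.mod_self]
  rw [this, Nat.succ_mul]
  omega

lemma trC_tight (φ : PLTL AP) (i : ℕ) :
    baTrC (tightRun α b p i) (tightRun α b p (i + 1)) φ := by
  have B := bv_tight α b p hp hper
  have V : ∀ i φ d, (tightRun α b p i).val φ d = ws α φ (pt b p i d) := fun _ _ _ => rfl
  have P1 := pt_nle α b p hp i
  have P2 := pt_le α b p i
  induction φ with
  | atom q => trivial
  | natom q => trivial
  | conj f g ihf ihg => exact ⟨ihf, ihg⟩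
  | disj f g ihf ihg => exact ⟨ihf, ihg⟩
  | next f ihf =>
    refine ⟨ihf, fun d _ => ⟨fun h => ?_, fun h => ?_⟩⟩
    · rw [V, B, P1 d h]; exact Iff.rfl
    · rw [V, B, P2 d h]; exact Iff.rfl
  | untl f g ihf ihg =>
    refine ⟨ihf, ihg, fun d _ => ⟨fun h => ?_, fun h => ?_⟩⟩
    · rw [V, B, B, B, P1 d h, ws_untl, ws_untl]; exact Un_step ..
    · rw [V, B, B, B, P2 d h, ws_untl, ws_untl]; exact Un_step ..
  | rels f g ihf ihg =>
    refine ⟨ihf, ihg, fun d _ => ⟨fun h => ?_, fun h => ?_⟩⟩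
    · rw [V, B, B, B, P1 d h, ws_rels, ws_rels, Un_step]; tauto
    · rw [V, B, B, B, P2 d h, ws_rels, ws_rels, Un_step]; tauto
  | prev f ihf =>
    refine ⟨ihf, fun d _ => ⟨fun h => ?_, fun h => ?_⟩⟩
    · rw [V, B, P1 d h]; simp [ws, PLTL.sat]
    · rw [B, B, P2 d h]; simp [ws, PLTL.sat]
  | wprev f ihf =>
    refine ⟨ihf, fun d _ => ⟨fun h => ?_, fun h => ?_⟩⟩
    · rw [V, B, P1 d h]; simp [ws, PLTL.sat]
    · rw [B, B, P2 d h]; simp [ws, PLTL.sat]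
  | since f g ihf ihg =>
    refine ⟨ihf, ihg, fun d _ => ⟨fun h => ?_, fun h => ?_⟩⟩
    · rw [V, V, B, B, P1 d h, ws_since, ws_since]; exact Sn_step ..
    · rw [V, B, B, B, P2 d h, ws_since, ws_since]; exact Sn_step ..
  | trig f g ihf ihg =>
    refine ⟨ihf, ihg, fun d _ => ⟨fun h => ?_, fun h => ?_⟩⟩
    · rw [V, V, B, B, P1 d h, ws_trig, ws_trig, Sn_step]; tauto
    · rw [V, B, B, B, P2 d h, ws_trig, ws_trig, Sn_step]; tauto

lemma hit (g : PLTL AP) (m : ℕ) (hm : g.delta ≤ m) (j : ℕ) (hj : b + m * p ≤ j) (N : ℕ) :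
    ∃ i, N ≤ i ∧ (bv (tightRun α b p i) g m ↔ ws α g j) := by
  refine ⟨j + N * p, ?_, ?_⟩
  · have := Nat.le_mul_of_pos_right N hp
    omega
  · rw [bv_tight α b p hp hper]
    unfold pt
    rw [if_neg (by omega), show j + N * p - b = (j - b) + N * p by omega, Nat.add_mul_mod_self_right]
    have hd := Nat.div_add_mod' (j - b) p
    have hmd : m ≤ (j - b) / p := (Nat.le_div_iff_mul_le hp).2 (by omega)
    obtain ⟨k, hk⟩ := Nat.exists_eq_add_of_le hmd
    rw [hk, Nat.add_mul] at hd
    have := ws_per_mul α b p hp hper g m hm (b + (j - b) % p + m * p) (by omega) k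
    rw [show b + (j - b) % p + m * p + k * p = j by omega] at this
    exact this.symm

end

end BMC

open BMC in
/-- Lemma (tightness of the Büchi automaton obtained by virtual unrolling):
for every ultimately periodic word `α = βγ^ω ∈ L(B^ψ)` (stem length `b = |β|`,
period `p = |γ| > 0`) there is an accepting run `ρ = στ^ω` of `B^ψ` on `α`
of the same shape, i.e. with `|σ| = b` and `|τ| = p`. -/
theorem tight_buchi_tight {AP : Type} (ψ : PLTL AP)
    (α : ℕ → Set AP) (b p : ℕ) (hp : 0 < p)
    (hper : ∀ i, b ≤ i → α (i + p) = α i)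
    (hlang : baLang ψ α) :
    ∃ ρ : ℕ → BASt AP, baRunOn ψ ρ α ∧ baAccepting ψ ρ ∧
      ∀ i, b ≤ i → ρ (i + p) = ρ i := by
  have B := bv_tight α b p hp hper
  have hge : ∀ i d, b ≤ i → b + d * p ≤ pt b p i d := by
    intro i d h
    unfold pt
    rw [if_neg (by omega)]
    omega
  have hst : ∀ i, baState ψ (tightRun α b p i) := fun i =>
    ⟨fun h => h.1, stC_tight α b p hp hper ψ i⟩
  refine ⟨tightRun α b p, ⟨⟨hst 0, initC_tight α b p hp hper ψ, ?_⟩, fun i => ⟨hst i, hst _, ?_,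
    trC_tight α b p hp hper ψ i⟩, ?_⟩, ⟨?_, ?_, ?_⟩, ?_⟩
  · have h0 : pt b p 0 0 = 0 := by
      unfold pt; split_ifs with h
      · rfl
      · obtain rfl : b = 0 := by omega
        simp
    rw [B, h0]
    exact lang_sat ψ α hlang
  · intro h
    simp only [tightRun] at h ⊢
    omega
  · intro i q
    have key : α (pt b p i 0) = α i := by
      unfold pt
      split_ifs with h
      · rfl
      · have hk : ∀ k j, b ≤ j → α (j + k * p) = α j := by
          intro k
          induction k with
          | zero => intro j _; simp
          | succ k ih =>
            intro j hj
            rw [Nat.succ_mul, ← Nat.add_assoc, hper _ (by omega), ih j hj]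
        have hd := Nat.div_add_mod' (i - b) p
        have := hk ((i - b) / p) (b + (i - b) % p) (by omega)
        rw [show b + (i - b) % p + (i - b) / p * p = i by omega] at this
        rw [this]; simp
    rw [← key]
    exact Iff.rfl
  · intro f g _ N
    by_contra hcon
    push Not at hcon
    have h1 := (hcon (max N b) (le_max_left _ _)).1
    rw [B, ws_untl] at h1
    obtain ⟨j, hj, hg, -⟩ := h1
    obtain ⟨i, hi, he⟩ := hit α b p hp hper g (PLTL.untl f g).delta (by simp [PLTL.delta]) j
      (le_trans (hge _ _ (le_max_right _ _)) hj) N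
    exact (hcon i hi).2 (he.2 hg)
  · intro f g _ N
    by_contra hcon
    push Not at hcon
    have h1 := (hcon (max N b) (le_max_left _ _)).1
    rw [B, ws_rels, not_not] at h1
    obtain ⟨j, hj, hg, -⟩ := h1
    obtain ⟨i, hi, he⟩ := hit α b p hp hper g (PLTL.rels f g).delta (by simp [PLTL.delta]) j
      (le_trans (hge _ _ (le_max_right _ _)) hj) N
    exact hg (he.1 (hcon i hi).2)
  · intro N
    have := Nat.le_mul_of_pos_right N hp
    refine ⟨b + (p - 1) + N * p, by omega, ?_, ?_⟩
    · omega
    · rw [show b + (p - 1) + N * p - b = (p - 1) + N * p by omega, Nat.add_mul_mod_self_right,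
        Nat.mod_eq_of_lt (by omega)]
      omega
  · intro i hi
    have h1 : (i + p - b) % p = (i - b) % p := by
      rw [show i + p - b = (i - b) + p by omega, Nat.add_mod_right]
    have h2 : ∀ d, pt b p (i + p) d = pt b p i d := by
      intro d
      unfold pt
      rw [if_neg (by omega), if_neg (by omega), h1]
    unfold tightRun
    simp only [h1, h2]
    congr 1
    · exact propext (by omega)
    · exact propext (by omega)
end
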